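/- arXiv:1912.10409 — 3 statements merged into one kernel-verified Lean document; each statement's English description precedes it below -/
import Mathlib

section
/- Let R be a ring, n ≥ 2, and m ≥ 0. Then R is m-Gorenstein if and only if R[t]/(t^n) is m-Gorenstein. -/
noncomputable section

namespace Paper

universe u

open Polynomial

variable (R : Type u) [Ring R] (n : ℕ)

/-- The defining relation of `R[t]/(t^n)`. -/
def truncRel (a b : Polynomial R) : Prop := a = Polynomial.X ^ n ∧ b = 0

/-- The ring `R[t]/(t^n)`: the quotient of the polynomial ring `R[t]` by the two-sided ideal
generated by `t^n`. -/
abbrev TruncPoly : Type u := RingQuot (truncRel R n)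

/-- The canonical projection `R[t] → R[t]/(t^n)`. -/
def truncMk : Polynomial R →+* TruncPoly R n := RingQuot.mkRingHom _

/-- The canonical ring homomorphism `R → R[t]/(t^n)`. -/
def truncC : R →+* TruncPoly R n := (truncMk R n).comp (Polynomial.C : R →+* Polynomial R)

/-- The image of `t` in `R[t]/(t^n)`. -/
def tgen : TruncPoly R n := truncMk R n Polynomial.X

section Dimensions

variable (Λ : Type u) [Ring Λ]

/-- The injective dimension of a left `Λ`-module `M` is at most `m`: there is an exact
coresolution `0 → M → I^0 → I^1 → ⋯ → I^m → 0` with all `I^j` injective. -/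
def injDimLE (M : Type u) [AddCommGroup M] [Module Λ M] (m : ℕ) : Prop :=
  ∃ (I : ℕ → Type u) (_ : ∀ j, AddCommGroup (I j)) (_ : ∀ j, Module Λ (I j))
    (d : ∀ j, I j →ₗ[Λ] I (j + 1)) (aug : M →ₗ[Λ] I 0),
    (∀ j, Module.Injective Λ (I j)) ∧
    Function.Injective aug ∧
    Function.Exact aug (d 0) ∧
    (∀ j, Function.Exact (d j) (d (j + 1))) ∧
    (∀ j, m < j → Subsingleton (I j))

/-- The projective dimension of a left `Λ`-module `M` is at most `k`: there is an exact
resolution `0 → P_k → ⋯ → P_1 → P_0 → M → 0` with all `P_j` projective. -/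
def projDimLE (M : Type u) [AddCommGroup M] [Module Λ M] (k : ℕ) : Prop :=
  ∃ (P : ℕ → Type u) (_ : ∀ j, AddCommGroup (P j)) (_ : ∀ j, Module Λ (P j))
    (d : ∀ j, P (j + 1) →ₗ[Λ] P j) (aug : P 0 →ₗ[Λ] M),
    (∀ j, Module.Projective Λ (P j)) ∧
    Function.Surjective aug ∧
    Function.Exact (d 0) aug ∧
    (∀ j, Function.Exact (d (j + 1)) (d j)) ∧
    (∀ j, k < j → Subsingleton (P j))

/-- A ring `Λ` is `m`-Gorenstein if it is left and right Noetherian and its self-injective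
dimensions on both sides are at most `m`. -/
def IsGorensteinRing (m : ℕ) : Prop :=
  IsNoetherianRing Λ ∧ IsNoetherianRing Λᵐᵒᵖ ∧ injDimLE Λ Λ m ∧ injDimLE Λᵐᵒᵖ Λᵐᵒᵖ m

end Dimensions

open CategoryTheory

section InjectiveDimension

variable (Λ : Type u) [Ring Λ]

/-- There is an injective coresolution `0 → M → I^0 → I^1 → ⋯` with `I^j = 0` for `j ≥ k`. -/
def HasInjCoresolutionLT (M : Type u) [AddCommGroup M] [Module Λ M] (k : ℕ) : Prop :=
  ∃ (I : ℕ → Type u) (_ : ∀ j, AddCommGroup (I j)) (_ : ∀ j, Module Λ (I j))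
    (d : ∀ j, I j →ₗ[Λ] I (j + 1)) (aug : M →ₗ[Λ] I 0),
    (∀ j, Module.Injective Λ (I j)) ∧
    Function.Injective aug ∧
    Function.Exact aug (d 0) ∧
    (∀ j, Function.Exact (d j) (d (j + 1))) ∧
    (∀ j, k ≤ j → Subsingleton (I j))

variable {Λ}

lemma injective_of_subsingleton (M : Type u) [AddCommGroup M] [Module Λ M] [Subsingleton M] :
    Module.Injective Λ M where
  out _ _ _ _ _ _ _ _ _ := ⟨0, fun _ => Subsingleton.elim _ _⟩

lemma HasInjCoresolutionLT.of_subsingleton (M : Type u) [AddCommGroup M] [Module Λ M]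
    [Subsingleton M] (k : ℕ) : HasInjCoresolutionLT Λ M k :=
  ⟨fun _ => PUnit, inferInstance, inferInstance, fun _ => 0, 0,
    fun _ => injective_of_subsingleton _, Function.injective_of_subsingleton _,
    fun x => by simp [Subsingleton.elim x 0], fun _ x => by simp [Subsingleton.elim x 0],
    fun _ _ => inferInstance⟩

/-- Splicing `0 → M → J → Q → 0`, `J` injective, with an injective coresolution of `Q`. -/
lemma HasInjCoresolutionLT.cons {M J Q : Type u} [AddCommGroup M] [Module Λ M]
    [AddCommGroup J] [Module Λ J] [AddCommGroup Q] [Module Λ Q] (hJ : Module.Injective Λ J)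
    {a : M →ₗ[Λ] J} {p : J →ₗ[Λ] Q} (ha : Function.Injective a) (hap : Function.Exact a p)
    (hp : Function.Surjective p) {k : ℕ} (hQ : HasInjCoresolutionLT Λ Q k) :
    HasInjCoresolutionLT Λ M (k + 1) := by
  obtain ⟨I, hI₁, hI₂, d, aug, hinj, haug, hex₀, hex, hsub⟩ := hQ
  let I' : ℕ → ModuleCat.{u} Λ := fun
    | 0 => .of Λ J
    | j + 1 => .of Λ (I j)
  let d' : ∀ j, I' j →ₗ[Λ] I' (j + 1) := fun
    | 0 => aug ∘ₗ p
    | j + 1 => d j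
  refine ⟨fun j => I' j, fun _ => inferInstance, fun _ => inferInstance, d', a, ?_, ha, ?_, ?_, ?_⟩
  · rintro (_ | j)
    exacts [hJ, hinj j]
  · exact (haug.comp_exact_iff_exact (f := a) (g := p) (i := aug)).2 hap
  · rintro (_ | j)
    · exact (hp.comp_exact_iff_exact (f := aug) (g := d 0) (p := p)).2 hex₀
    · exact hex j
  · rintro (_ | j) hj
    · omega
    · exact hsub j (by omega)

lemma hasInjCoresolutionLT_of_hasInjectiveDimensionLT (M : ModuleCat.{u} Λ) (k : ℕ)
    (h : HasInjectiveDimensionLT M k) : HasInjCoresolutionLT Λ M k := by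
  induction k generalizing M with
  | zero =>
    have : Subsingleton M := ModuleCat.subsingleton_of_isZero
      (isZero_of_hasInjectiveDimensionLT_zero M)
    exact .of_subsingleton _ _
  | succ k ih =>
    obtain _ | k := k
    · have : Injective M := injective_iff_hasInjectiveDimensionLT_one.2 h
      have : Module.Injective Λ M := Module.injective_module_of_injective_object Λ M
      exact .cons (J := M) (Q := PUnit) this (a := LinearMap.id) (p := 0)
        Function.injective_id (fun x => by simp) (fun x => ⟨0, rfl⟩) (.of_subsingleton _ 0)
    · let ⟨I, _, f, _⟩ := EnoughInjectives.presentation M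
      have injf : Function.Injective f.hom := (ModuleCat.mono_iff_injective f).mp ‹_›
      let S : ShortComplex (ModuleCat.{u} Λ) :=
        ModuleCat.shortComplexOfCompEqZero _ _ f.hom.exact_map_mkQ_range.linearMap_comp_eq_zero
      have exactS := ModuleCat.shortComplex_shortExact S
        f.hom.exact_map_mkQ_range injf (Submodule.mkQ_surjective _)
      exact .cons (Module.injective_module_of_injective_object Λ I) injf
        f.hom.exact_map_mkQ_range (Submodule.mkQ_surjective _)
        (ih _ ((exactS.hasInjectiveDimensionLT_X₃_iff k inferInstance).2 h))

lemma hasInjectiveDimensionLT_of_hasInjCoresolutionLT (M : Type u) [AddCommGroup M] [Module Λ M]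
    (k : ℕ) (h : HasInjCoresolutionLT Λ M k) :
    HasInjectiveDimensionLT (ModuleCat.of Λ M) k := by
  induction k generalizing M with
  | zero =>
    obtain ⟨I, hI₁, hI₂, d, aug, hinj, haug, hex₀, hex, hsub⟩ := h
    have := hsub 0 le_rfl
    have : Subsingleton M := haug.subsingleton
    exact (ModuleCat.isZero_of_subsingleton _).hasInjectiveDimensionLT_zero
  | succ k ih =>
    obtain ⟨I, hI₁, hI₂, d, aug, hinj, haug, hex₀, hex, hsub⟩ := h
    let S : ShortComplex (ModuleCat.{u} Λ) :=
      ModuleCat.shortComplexOfCompEqZero _ _ aug.exact_map_mkQ_range.linearMap_comp_eq_zero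
    have exactS := ModuleCat.shortComplex_shortExact S
      aug.exact_map_mkQ_range haug (Submodule.mkQ_surjective _)
    have hle : LinearMap.range aug ≤ LinearMap.ker (d 0) := hex₀.linearMap_ker_eq.ge
    have hQ : HasInjCoresolutionLT Λ (I 0 ⧸ LinearMap.range aug) k := by
      refine ⟨fun j => I (j + 1), fun j => hI₁ _, fun j => hI₂ _, fun j => d (j + 1),
        (LinearMap.range aug).liftQ (d 0) hle, fun j => hinj _, ?_, ?_, fun j => hex _,
        fun j hj => hsub _ (by omega)⟩
      · rw [← LinearMap.ker_eq_bot, Submodule.ker_liftQ_eq_bot']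
        exact hex₀.linearMap_ker_eq.symm
      · refine ((Submodule.mkQ_surjective _).comp_exact_iff_exact
          (p := (LinearMap.range aug).mkQ)).1 ?_
        exact hex 0
    have : Injective (ModuleCat.of Λ (I 0)) :=
      (Module.injective_iff_injective_object Λ (I 0)).1 (hinj 0)
    have : HasInjectiveDimensionLT (ModuleCat.of Λ (I 0)) (k + 1) :=
      hasInjectiveDimensionLT_of_ge _ 1 _ (by omega)
    exact exactS.hasInjectiveDimensionLT_X₁ k (ih _ hQ) this

lemma injDimLE_iff_hasInjectiveDimensionLE (M : Type u) [AddCommGroup M] [Module Λ M] (m : ℕ) :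
    injDimLE Λ M m ↔ HasInjectiveDimensionLE (ModuleCat.of Λ M) m :=
  ⟨hasInjectiveDimensionLT_of_hasInjCoresolutionLT M (m + 1),
    hasInjCoresolutionLT_of_hasInjectiveDimensionLT (ModuleCat.of Λ M) (m + 1)⟩

lemma hasInjectiveDimensionLE_obj {Λ' : Type u} [Ring Λ']
    (F : ModuleCat.{u} Λ ⥤ ModuleCat.{u} Λ') [F.PreservesZeroMorphisms]
    (hF : ∀ S : ShortComplex (ModuleCat.{u} Λ), S.ShortExact → (S.map F).ShortExact)
    (hI : ∀ I : ModuleCat.{u} Λ, Injective I → Injective (F.obj I)) (M : ModuleCat.{u} Λ) (m : ℕ)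
    (h : HasInjectiveDimensionLE M m) : HasInjectiveDimensionLE (F.obj M) m := by
  induction m generalizing M with
  | zero =>
    exact injective_iff_hasInjectiveDimensionLT_one.1
      (hI _ (injective_iff_hasInjectiveDimensionLT_one.2 h))
  | succ m ih =>
    let ⟨I, _, f, _⟩ := EnoughInjectives.presentation M
    have injf : Function.Injective f.hom := (ModuleCat.mono_iff_injective f).mp ‹_›
    let S : ShortComplex (ModuleCat.{u} Λ) :=
      ModuleCat.shortComplexOfCompEqZero _ _ f.hom.exact_map_mkQ_range.linearMap_comp_eq_zero
    have exactS : S.ShortExact := ModuleCat.shortComplex_shortExact S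
      f.hom.exact_map_mkQ_range injf (Submodule.mkQ_surjective _)
    exact ((hF S exactS).hasInjectiveDimensionLT_X₃_iff m (hI I inferInstance)).1
      (ih _ ((exactS.hasInjectiveDimensionLT_X₃_iff m inferInstance).2 h))

end InjectiveDimension

section TruncatedPolynomialRing

variable {R} {Λ : Type u} [Ring Λ]

/-- The ring `Λ`, with the map `f : R → Λ`, the central element `t` and the coefficient functions
`c i`, is a truncated polynomial ring `R[t]/(t^n)`. -/
structure IsTruncatedPolynomialRing (f : R →+* Λ) (t : Λ) (n : ℕ) (c : ℕ → Λ →+ R) : Prop where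
  commute (s : Λ) : Commute t s
  pow_eq_zero : t ^ n = 0
  coeff_mul_left (i : ℕ) (r : R) (s : Λ) : c i (f r * s) = r * c i s
  coeff_mul_right (i : ℕ) (r : R) (s : Λ) : c i (s * f r) = c i s * r
  coeff_zero_mul (s : Λ) : c 0 (t * s) = 0
  coeff_succ_mul (i : ℕ) (hi : i + 1 < n) (s : Λ) : c (i + 1) (t * s) = c i s
  coeff_one (i : ℕ) (hi : i < n) : c i 1 = if i = 0 then 1 else 0
  sum_coeff (s : Λ) : ∑ i ∈ Finset.range n, f (c i s) * t ^ i = s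

namespace IsTruncatedPolynomialRing

variable {f : R →+* Λ} {t : Λ} {n} {c : ℕ → Λ →+ R}

lemma op (h : IsTruncatedPolynomialRing f t n c) :
    IsTruncatedPolynomialRing f.op (MulOpposite.op t) n
      (fun i => MulOpposite.opAddEquiv.toAddMonoidHom.comp
        ((c i).comp MulOpposite.opAddEquiv.symm.toAddMonoidHom)) where
  commute s := MulOpposite.unop_injective (h.commute s.unop).symm
  pow_eq_zero := MulOpposite.unop_injective h.pow_eq_zero
  coeff_mul_left i r s := MulOpposite.unop_injective (h.coeff_mul_right i r.unop s.unop)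
  coeff_mul_right i r s := MulOpposite.unop_injective (h.coeff_mul_left i r.unop s.unop)
  coeff_zero_mul s := MulOpposite.unop_injective <| by
    simpa [← (h.commute s.unop).eq] using h.coeff_zero_mul s.unop
  coeff_succ_mul i hi s := MulOpposite.unop_injective <| by
    simpa [← (h.commute s.unop).eq] using h.coeff_succ_mul i hi s.unop
  coeff_one i hi := MulOpposite.unop_injective <| by
    simpa [apply_ite MulOpposite.unop] using h.coeff_one i hi
  sum_coeff s := MulOpposite.unop_injective <| by
    simpa [← ((h.commute _).pow_left _).eq] using h.sum_coeff s.unop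

lemma coeff_pow_mul (h : IsTruncatedPolynomialRing f t n c) (i j : ℕ) (hij : i + j < n) (s : Λ) :
    c (i + j) (t ^ j * s) = c i s := by
  induction j with
  | zero => simp
  | succ j ih =>
    rw [pow_succ', mul_assoc, ← add_assoc, h.coeff_succ_mul (i + j) (by omega), ih (by omega)]

lemma coeff_pow_mul_of_lt (h : IsTruncatedPolynomialRing f t n c) (i j : ℕ) (hij : i < j)
    (hi : i < n) (s : Λ) : c i (t ^ j * s) = 0 := by
  induction i generalizing j with
  | zero =>
    obtain ⟨j, rfl⟩ := Nat.exists_eq_succ_of_ne_zero hij.ne'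
    rw [Nat.succ_eq_add_one, pow_succ', mul_assoc, h.coeff_zero_mul]
  | succ i ih =>
    obtain ⟨j, rfl⟩ := Nat.exists_eq_succ_of_ne_zero (by omega : j ≠ 0)
    rw [Nat.succ_eq_add_one, pow_succ', mul_assoc, h.coeff_succ_mul _ hi, ih _ (by omega) (by omega)]

lemma coeff_map (h : IsTruncatedPolynomialRing f t n c) (i : ℕ) (hi : i < n) (r : R) :
    c i (f r) = if i = 0 then r else 0 := by
  rw [← mul_one (f r), h.coeff_mul_left, h.coeff_one i hi]
  simp

lemma coeff_pow (h : IsTruncatedPolynomialRing f t n c) (i j : ℕ) (hi : i < n) :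
    c i (t ^ j) = if i = j then 1 else 0 := by
  rcases lt_or_ge i j with hij | hij
  · simpa [hij.ne] using h.coeff_pow_mul_of_lt i j hij hi 1
  · obtain ⟨k, rfl⟩ := Nat.exists_eq_add_of_le' hij
    have := h.coeff_pow_mul k j hi 1
    rw [mul_one, h.coeff_one k (by omega)] at this
    simp [this]

lemma coeff_sum (h : IsTruncatedPolynomialRing f t n c) (a : ℕ → R) (i : ℕ) (hi : i < n) :
    c i (∑ j ∈ Finset.range n, f (a j) * t ^ j) = a i := by
  simp only [map_sum, h.coeff_mul_left, h.coeff_pow i _ hi]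
  simp [hi]

lemma ext (h : IsTruncatedPolynomialRing f t n c) {s s' : Λ} (hs : ∀ i < n, c i s = c i s') :
    s = s' := by
  rw [← h.sum_coeff s, ← h.sum_coeff s']
  exact Finset.sum_congr rfl fun i hi => by rw [hs i (Finset.mem_range.1 hi)]

lemma coeff_zero_mul_eq (h : IsTruncatedPolynomialRing f t n c) (hn : 0 < n) (s s' : Λ) :
    c 0 (s * s') = c 0 s * c 0 s' := by
  conv_lhs => rw [← h.sum_coeff s, Finset.sum_mul, map_sum]
  rw [Finset.sum_eq_single 0]
  · simp [h.coeff_mul_left]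
  · intro j _ hj
    rw [mul_assoc, h.coeff_mul_left, h.coeff_pow_mul_of_lt 0 j (by omega) hn, mul_zero]
  · simp [hn]

lemma isNoetherianRing_base (h : IsTruncatedPolynomialRing f t n c) (hn : 0 < n)
    [IsNoetherianRing Λ] : IsNoetherianRing R := by
  let φ : Λ →+* R :=
    { c 0 with
      map_one' := by simpa using h.coeff_one 0 hn
      map_mul' := h.coeff_zero_mul_eq hn }
  exact isNoetherianRing_of_surjective Λ R φ fun r =>
    ⟨f r, (h.coeff_map 0 hn r).trans (if_pos rfl)⟩

lemma isNoetherianRing (h : IsTruncatedPolynomialRing f t n c) [IsNoetherianRing R] :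
    IsNoetherianRing Λ := by
  let : Module R Λ := Module.compHom Λ f
  have : IsScalarTower R Λ Λ := ⟨fun r a b => mul_assoc (f r) a b⟩
  let φ : Λ →ₗ[R] (Fin n → R) :=
    { toFun := fun s i => c i s
      map_add' := fun s s' => funext fun i => map_add (c i) s s'
      map_smul' := fun r s => funext fun i => h.coeff_mul_left i r s }
  have : IsNoetherian R Λ := isNoetherian_of_injective φ <|
    fun s s' hs => h.ext fun i hi => congrFun hs ⟨i, hi⟩
  exact isNoetherian_of_tower R this

/-- A map `g : J → I` on a left ideal of `R` extends to the left ideal of elements of `Λ` with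
coefficients in `J`, as `s ↦ ∑ i, t ^ i • g (c i s)`. -/
lemma baer_restrictScalars (h : IsTruncatedPolynomialRing f t n c) (I : ModuleCat.{u} Λ)
    (hI : Module.Baer Λ I) : Module.Baer R ((ModuleCat.restrictScalars f).obj I) := by
  intro J g
  let K : Submodule Λ Λ :=
    { carrier := {s | ∀ i < n, c i s ∈ J}
      add_mem' := fun ha hb i hi => by rw [map_add]; exact J.add_mem (ha i hi) (hb i hi)
      zero_mem' := fun i _ => by simp
      smul_mem' := fun s x hx i hi => by
        rw [smul_eq_mul, ← h.sum_coeff s, Finset.sum_mul, map_sum]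
        refine J.sum_mem fun j _ => ?_
        rw [mul_assoc, h.coeff_mul_left]
        refine J.smul_mem _ ?_
        rcases lt_or_ge i j with hij | hij
        · rw [h.coeff_pow_mul_of_lt i j hij hi]
          exact J.zero_mem
        · obtain ⟨k, rfl⟩ := Nat.exists_eq_add_of_le' hij
          rw [h.coeff_pow_mul k j hi]
          exact hx k (by omega) }
  let g' : J →+ I := g.toAddMonoidHom
  have hg' (r : R) (x : J) : g' (r • x) = f r • g' x := g.map_smul r x
  let G : K →+ I :=
    { toFun := fun s => ∑ i : Fin n, t ^ (i : ℕ) • g' ⟨c i s.1, s.2 i i.2⟩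
      map_zero' := Finset.sum_eq_zero fun i _ => by
        have : (⟨c i (0 : K).1, (0 : K).2 i i.2⟩ : J) = 0 := Subtype.ext (map_zero (c i))
        rw [this, map_zero, smul_zero]
      map_add' := fun s s' => by
        rw [← Finset.sum_add_distrib]
        refine Finset.sum_congr rfl fun i _ => ?_
        rw [← smul_add, ← map_add]
        congr 2
        exact Subtype.ext (map_add (c i) _ _) }
  have hGr (r : R) (x : K) : G (f r • x) = f r • G x := by
    change ∑ i : Fin n, _ = f r • ∑ i : Fin n, _
    rw [Finset.smul_sum]
    refine Finset.sum_congr rfl fun i _ => ?_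
    rw [← mul_smul, ← ((h.commute (f r)).pow_left _).eq, mul_smul, ← hg']
    congr 2
    exact Subtype.ext (h.coeff_mul_left i r x)
  have hGt (x : K) : G (t • x) = t • G x := by
    obtain _ | n := n
    · have : t = 0 := by
        have h1 : (1 : Λ) = 0 := by simpa using h.pow_eq_zero
        rw [← mul_one t, h1, mul_zero]
      simp [this]
    change ∑ i : Fin (n + 1), _ = t • ∑ i : Fin (n + 1), _
    rw [Finset.smul_sum, Fin.sum_univ_succ, Fin.sum_univ_castSucc]
    have h0 : (⟨c (0 : Fin (n + 1)) (t • x).1, (t • x).2 0 (0 : Fin (n + 1)).2⟩ : J) = 0 :=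
      Subtype.ext (h.coeff_zero_mul x)
    have hlast (y : I) : t • t ^ (Fin.last n : ℕ) • y = 0 := by
      rw [← mul_smul, Fin.val_last, ← pow_succ', h.pow_eq_zero, zero_smul]
    rw [hlast, add_zero]
    refine (congrArg₂ (· + ·) ?_ ?_).trans (zero_add _)
    · exact (congrArg (fun y => t ^ ((0 : Fin (n + 1)) : ℕ) • g' y) h0).trans (by simp)
    · refine Finset.sum_congr rfl fun i _ => ?_
      rw [← mul_smul, ← pow_succ']
      congr 2
      exact Subtype.ext (h.coeff_succ_mul i (by omega) x)
  have hGpow (j : ℕ) (x : K) : G (t ^ j • x) = t ^ j • G x := by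
    induction j with
    | zero => simp
    | succ j ih => rw [pow_succ', mul_smul, hGt, ih, mul_smul]
  have hG (s : Λ) (x : K) : G (s • x) = s • G x := by
    rw [← h.sum_coeff s, Finset.sum_smul, Finset.sum_smul, map_sum]
    exact Finset.sum_congr rfl fun i _ => by rw [mul_smul, hGr, hGpow, mul_smul]
  obtain ⟨φ, hφ⟩ := hI K { G with map_smul' := hG }
  refine ⟨{ toFun := fun r => φ (f r), map_add' := fun a b => by rw [map_add, map_add]; rfl,
            map_smul' := fun r a => ?_ }, fun r hr => ?_⟩
  · change φ (f (r * a)) = f r • φ (f a)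
    rw [map_mul, ← smul_eq_mul, map_smul]
  · have hmem : f r ∈ K := fun i hi => by
      rw [h.coeff_map i hi]
      split_ifs
      exacts [hr, J.zero_mem]
    refine (hφ (f r) hmem).trans ?_
    change ∑ i : Fin n, t ^ (i : ℕ) • g' ⟨c i (f r), hmem i i.2⟩ = g' ⟨r, hr⟩
    obtain _ | n := n
    · have h1 : (1 : Λ) = 0 := by simpa using h.pow_eq_zero
      rw [← one_smul Λ (g' ⟨r, hr⟩), h1]
      simp
    rw [Fin.sum_univ_succ, Finset.sum_eq_zero, add_zero]
    · have : (⟨c (0 : Fin (n + 1)) (f r), hmem 0 (0 : Fin (n + 1)).2⟩ : J) = ⟨r, hr⟩ :=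
        Subtype.ext ((h.coeff_map 0 (by omega) r).trans (if_pos rfl))
      rw [this]
      simp
    · intro i _
      have : (⟨c i.succ (f r), hmem i.succ i.succ.2⟩ : J) = 0 :=
        Subtype.ext ((h.coeff_map _ i.succ.2 r).trans (if_neg (by simp)))
      rw [this, map_zero, smul_zero]

lemma hasInjectiveDimensionLE_base (h : IsTruncatedPolynomialRing f t n c) (hn : 0 < n) (m : ℕ)
    (hΛ : HasInjectiveDimensionLE (ModuleCat.of Λ Λ) m) :
    HasInjectiveDimensionLE (ModuleCat.of R R) m := by
  have : HasInjectiveDimensionLE ((ModuleCat.restrictScalars f).obj (ModuleCat.of Λ Λ)) m := by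
    refine hasInjectiveDimensionLE_obj _ (fun S hS => ?_) (fun I hI => ?_) _ m hΛ
    · exact ModuleCat.shortComplex_shortExact _
        ((ShortComplex.ShortExact.moduleCat_exact_iff_function_exact S).1 hS.exact)
        hS.moduleCat_injective_f hS.moduleCat_surjective_g
    · have hI' : Module.Injective Λ I := Module.injective_module_of_injective_object Λ I
      have := (h.baer_restrictScalars I (Module.Baer.of_injective hI')).injective
      exact Module.injective_object_of_injective_module R ((ModuleCat.restrictScalars f).obj I)
  let r : Retract (ModuleCat.of R R) ((ModuleCat.restrictScalars f).obj (ModuleCat.of Λ Λ)) :=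
    { i := ModuleCat.ofHom (Y := (ModuleCat.restrictScalars f).obj (ModuleCat.of Λ Λ))
        { toFun := f
          map_add' := map_add f
          map_smul' := map_mul f }
      r := ModuleCat.ofHom (X := (ModuleCat.restrictScalars f).obj (ModuleCat.of Λ Λ))
        { toFun := c 0
          map_add' := map_add (c 0)
          map_smul' := h.coeff_mul_left 0 }
      retract := ModuleCat.hom_ext <| LinearMap.ext fun x =>
        (h.coeff_map 0 hn x).trans (if_pos rfl) }
  exact r.hasInjectiveDimensionLT _

/-- An `R`-linear map out of `Λ` can be prescribed freely on the powers of `t`. -/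
lemma exists_linearMap (h : IsTruncatedPolynomialRing f t n c) (M : ModuleCat.{u} R) (a : ℕ → M) :
    ∃ φ : (ModuleCat.restrictScalars f).obj (ModuleCat.of Λ Λ) →ₗ[R] M,
      ∀ s : Λ, φ s = ∑ i ∈ Finset.range n, c i s • a i :=
  ⟨{ toFun := fun s => ∑ i ∈ Finset.range n, c i s • a i
     map_add' := fun s s' => by
       rw [← Finset.sum_add_distrib]
       refine Finset.sum_congr rfl fun i _ => ?_
       rw [← add_smul]
       exact congrArg (· • a i) (map_add (c i) s s')
     map_smul' := fun r s => by
       rw [RingHom.id_apply, Finset.smul_sum]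
       refine Finset.sum_congr rfl fun i _ => ?_
       rw [smul_smul]
       exact congrArg (· • a i) (h.coeff_mul_left i r s) }, fun s => rfl⟩

lemma linearMap_apply (h : IsTruncatedPolynomialRing f t n c) {M : ModuleCat.{u} R}
    (φ : (ModuleCat.restrictScalars f).obj (ModuleCat.of Λ Λ) →ₗ[R] M) (s : Λ) :
    φ s = ∑ i ∈ Finset.range n, c i s • φ (t ^ i : Λ) := by
  let φ' : Λ →+ M := φ.toAddMonoidHom
  have hφ (r : R) (x : Λ) : φ' (f r * x) = r • φ' x := φ.map_smul r x
  change φ' s = ∑ i ∈ Finset.range n, c i s • φ' (t ^ i)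
  conv_lhs => rw [← h.sum_coeff s, map_sum]
  simp only [hφ]

lemma coextendScalars_shortExact (h : IsTruncatedPolynomialRing f t n c)
    (S : ShortComplex (ModuleCat.{u} R)) (hS : S.ShortExact) :
    (S.map (ModuleCat.coextendScalars.{u, u, u} f)).ShortExact := by
  have hfg := (ShortComplex.ShortExact.moduleCat_exact_iff_function_exact S).1 hS.exact
  have hf := hS.moduleCat_injective_f
  have hg := hS.moduleCat_surjective_g
  have lift {M N : ModuleCat.{u} R} (p : M ⟶ N)
      (y : (ModuleCat.coextendScalars.{u, u, u} f).obj N)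
      (hy : ∀ s : Λ, ∃ x, p x = y s) :
      ∃ x, (ModuleCat.coextendScalars.{u, u, u} f).map p x = y := by
    choose a ha using fun i : ℕ => hy (t ^ i)
    obtain ⟨φ, hφ⟩ := h.exists_linearMap M a
    refine ⟨(ModuleCat.CoextendScalars.equiv f M).symm φ,
      ModuleCat.CoextendScalars.ext <| LinearMap.ext fun s => ?_⟩
    refine Eq.trans ?_ (h.linearMap_apply (ModuleCat.CoextendScalars.equiv f N y) s).symm
    refine (congrArg p (hφ s)).trans ?_
    rw [map_sum]
    exact Finset.sum_congr rfl fun i _ => by rw [map_smul, ha]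
  refine ModuleCat.shortComplex_shortExact _ (fun y => ⟨fun hy => ?_, ?_⟩) (fun y y' hy => ?_)
    (fun y => lift S.g y fun s => hg _)
  · exact lift S.f y fun s => (hfg _).1 <|
      congrArg (fun z => ModuleCat.CoextendScalars.equiv f _ z s) hy
  · rintro ⟨x, rfl⟩
    exact ModuleCat.CoextendScalars.ext <| LinearMap.ext fun s => (hfg _).2 ⟨_, rfl⟩
  · exact ModuleCat.CoextendScalars.ext <| LinearMap.ext fun s =>
      hf <| congrArg (fun z => ModuleCat.CoextendScalars.equiv f _ z s) hy

/-- The map `s ↦ (s' ↦ c (n - 1) (s' * s))` is an isomorphism from `Λ` to the module coinduced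
from `R`. -/
lemma nonempty_iso_coextendScalars (h : IsTruncatedPolynomialRing f t n c) (hn : 0 < n) :
    Nonempty ((ModuleCat.coextendScalars.{u, u, u} f).obj (ModuleCat.of R R) ≅
      ModuleCat.of Λ Λ) := by
  let e := ModuleCat.CoextendScalars.equiv f (ModuleCat.of R R)
  let Φ : Λ →ₗ[Λ] (ModuleCat.coextendScalars.{u, u, u} f).obj (ModuleCat.of R R) :=
    { toFun := fun s => e.symm
        { toFun := fun (s' : Λ) => c (n - 1) (s' * s)
          map_add' := fun x y =>
            (congrArg (c (n - 1)) (add_mul (R := Λ) x y s)).trans (map_add _ _ _)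
          map_smul' := fun r x => (congrArg (c (n - 1)) (mul_assoc (G := Λ) (f r) x s)).trans
            (h.coeff_mul_left _ _ _) }
      map_add' := fun s s' => ModuleCat.CoextendScalars.ext <| LinearMap.ext fun (x : Λ) =>
        (congrArg (c (n - 1)) (mul_add x s s')).trans (map_add _ _ _)
      map_smul' := fun r s => ModuleCat.CoextendScalars.ext <| LinearMap.ext fun (x : Λ) =>
        congrArg (c (n - 1)) (mul_assoc x r s).symm }
  have hΦ (s : Λ) (i : ℕ) (hi : i < n) : e (Φ s) (t ^ i : Λ) = c (n - 1 - i) s := by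
    change c (n - 1) (t ^ i * s) = _
    conv_lhs => rw [← Nat.sub_add_cancel (by omega : i ≤ n - 1)]
    exact h.coeff_pow_mul _ _ (by omega) s
  have hbij : Function.Bijective Φ := by
    refine ⟨fun s s' hs => h.ext fun i hi => ?_, fun φ => ?_⟩
    · have h₁ := hΦ s (n - 1 - i) (by omega)
      have h₂ := hΦ s' (n - 1 - i) (by omega)
      rw [show n - 1 - (n - 1 - i) = i by omega] at h₁ h₂
      rw [← h₁, ← h₂, hs]
    · let a : ℕ → R := fun j => e φ (t ^ (n - 1 - j) : Λ)
      refine ⟨∑ j ∈ Finset.range n, f (a j) * t ^ j,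
        ModuleCat.CoextendScalars.ext <| LinearMap.ext fun (s : Λ) => ?_⟩
      refine (h.linearMap_apply (e _) s).trans ((h.linearMap_apply (e φ) s).trans ?_).symm
      refine Finset.sum_congr rfl fun i hi => congrArg (c i s • ·) ?_
      have hi := Finset.mem_range.1 hi
      rw [hΦ _ i hi, h.coeff_sum a _ (by omega)]
      simp only [a, show n - 1 - (n - 1 - i) = i by omega]
  exact ⟨(LinearEquiv.ofBijective Φ hbij).toModuleIso.symm⟩

lemma hasInjectiveDimensionLE (h : IsTruncatedPolynomialRing f t n c) (hn : 0 < n) (m : ℕ)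
    (hR : HasInjectiveDimensionLE (ModuleCat.of R R) m) :
    HasInjectiveDimensionLE (ModuleCat.of Λ Λ) m := by
  have : HasInjectiveDimensionLE
      ((ModuleCat.coextendScalars.{u, u, u} f).obj (ModuleCat.of R R)) m := by
    refine hasInjectiveDimensionLE_obj _ h.coextendScalars_shortExact (fun I hI => ?_) _ m hR
    exact Injective.injective_of_adjoint (ModuleCat.restrictCoextendScalarsAdj f) I
  obtain ⟨e⟩ := h.nonempty_iso_coextendScalars hn
  exact hasInjectiveDimensionLT_of_iso e _

end IsTruncatedPolynomialRing

end TruncatedPolynomialRing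

section TruncPoly

/-- Congruence of polynomials modulo `X ^ n`: the coefficients below `n` agree. -/
def truncCon : RingCon R[X] where
  r p q := ∀ i < n, p.coeff i = q.coeff i
  iseqv := ⟨fun _ _ _ => rfl, fun h i hi => (h i hi).symm, fun h h' i hi =>
    (h i hi).trans (h' i hi)⟩
  add' h h' i hi := by rw [coeff_add, coeff_add, h i hi, h' i hi]
  mul' h h' i hi := by
    rw [coeff_mul, coeff_mul]
    refine Finset.sum_congr rfl fun x hx => ?_
    have := Finset.HasAntidiagonal.mem_antidiagonal.1 hx
    rw [h _ (by omega), h' _ (by omega)]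

lemma exists_truncCoeff : ∃ c : ℕ → TruncPoly R n →+ R,
    ∀ i p, c i (truncMk R n p) = if i < n then p.coeff i else 0 := by
  let L : TruncPoly R n →+* (truncCon R n).Quotient := RingQuot.lift ⟨(truncCon R n).mk', by
    rintro _ _ ⟨rfl, rfl⟩
    exact ((truncCon R n).eq).2 fun i hi => by simp [coeff_X_pow, hi.ne]⟩
  have hL (p) : L (truncMk R n p) = (truncCon R n).mk' p := RingQuot.lift_mkRingHom_apply _ _ p
  have hc (i : ℕ) : ∃ c : TruncPoly R n →+ R,
      ∀ p, c (truncMk R n p) = if i < n then p.coeff i else 0 := by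
    by_cases hi : i < n
    · let D : (truncCon R n).Quotient →+ R :=
        (truncCon R n).toAddCon.lift (lcoeff R i).toAddMonoidHom fun p q hpq => hpq i hi
      exact ⟨D.comp L.toAddMonoidHom, fun p => (congrArg D (hL p)).trans (if_pos hi).symm⟩
    · exact ⟨0, fun p => (if_neg hi).symm⟩
  choose c hc using hc
  exact ⟨c, hc⟩

lemma exists_isTruncatedPolynomialRing :
    ∃ c, IsTruncatedPolynomialRing (truncC R n) (tgen R n) n c := by
  obtain ⟨c, hc⟩ := exists_truncCoeff R n
  have hsurj : Function.Surjective (truncMk R n) := RingQuot.mkRingHom_surjective _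
  have hpow : tgen R n ^ n = 0 := by
    rw [tgen, ← map_pow, ← map_zero (truncMk R n)]
    exact RingQuot.mkRingHom_rel ⟨rfl, rfl⟩
  refine ⟨c, ⟨hsurj.forall.2 fun p => ?_, hpow, fun i r => hsurj.forall.2 fun p => ?_,
    fun i r => hsurj.forall.2 fun p => ?_, hsurj.forall.2 fun p => ?_,
    fun i hi => hsurj.forall.2 fun p => ?_, fun i hi => ?_, hsurj.forall.2 fun p => ?_⟩⟩
  · exact (commute_X p).map (truncMk R n)
  · rw [truncC, RingHom.comp_apply, ← map_mul, hc, hc, coeff_C_mul, mul_ite, mul_zero]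
  · rw [truncC, RingHom.comp_apply, ← map_mul, hc, hc, coeff_mul_C, ite_mul, zero_mul]
  · rw [tgen, ← map_mul, hc, mul_coeff_zero, coeff_X_zero, zero_mul, ite_self]
  · rw [tgen, ← map_mul, hc, hc, coeff_X_mul, if_pos hi, if_pos (by omega)]
  · rw [← map_one (truncMk R n), hc, if_pos hi, coeff_one]
  · have hterm (i : ℕ) (a : R) : truncMk R n (C a * X ^ i) = truncC R n a * tgen R n ^ i := by
      rw [map_mul, map_pow, truncC, tgen, RingHom.comp_apply]
    conv_rhs => rw [p.as_sum_range_C_mul_X_pow' (n := n + p.natDegree + 1) (by omega), map_sum]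
    refine Finset.sum_subset_zero_on_sdiff (fun i hi => ?_) (fun i hi => ?_) fun i hi => ?_
    · simp only [Finset.mem_range] at hi ⊢
      omega
    · simp only [Finset.mem_sdiff, Finset.mem_range, not_lt] at hi
      rw [hterm, ← Nat.add_sub_cancel' hi.2, pow_add, hpow, zero_mul, mul_zero]
    · rw [hterm, hc, if_pos (Finset.mem_range.1 hi)]

end TruncPoly

theorem isGorensteinRing_iff_of_isTruncatedPolynomialRing {R Λ : Type u} [Ring R] [Ring Λ]
    {f : R →+* Λ} {t : Λ} {n : ℕ} {c : ℕ → Λ →+ R} (h : IsTruncatedPolynomialRing f t n c)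
    (hn : 0 < n) (m : ℕ) : IsGorensteinRing R m ↔ IsGorensteinRing Λ m := by
  simp only [IsGorensteinRing, injDimLE_iff_hasInjectiveDimensionLE]
  constructor
  · rintro ⟨_, _, h₁, h₂⟩
    exact ⟨h.isNoetherianRing, h.op.isNoetherianRing, h.hasInjectiveDimensionLE hn m h₁,
      h.op.hasInjectiveDimensionLE hn m h₂⟩
  · rintro ⟨_, _, h₁, h₂⟩
    exact ⟨h.isNoetherianRing_base hn, h.op.isNoetherianRing_base hn,
      h.hasInjectiveDimensionLE_base hn m h₁, h.op.hasInjectiveDimensionLE_base hn m h₂⟩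

/-- **Statement 9.** For any `m ≥ 0`, `R` is `m`-Gorenstein iff `R[t]/(t^n)` is
`m`-Gorenstein. -/
theorem statement9 (R : Type u) [Ring R] (n : ℕ) (hn : 2 ≤ n) (m : ℕ) :
    IsGorensteinRing R m ↔ IsGorensteinRing (TruncPoly R n) m := by
  obtain ⟨c, hc⟩ := exists_isTruncatedPolynomialRing R n
  exact isGorensteinRing_iff_of_isTruncatedPolynomialRing hc (by omega) m

end Paper
end
end

section
/- Let R be an Artin algebra and n ≥ 2. Then the finitistic dimension of R is finite if and only if the finitistic dimension of R[t]/(t^n) is finite; that is, R satisfies the Finitistic Dimension Conjecture if and only if R[t]/(t^n) does. -/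
noncomputable section

namespace Paper

universe u

open Polynomial

variable (R : Type u) [Ring R] (n : ℕ)

variable (Λ : Type u) [Ring Λ] in
/-- The finitistic dimension of `Λ` is finite: there is a uniform bound on the projective
dimensions of the finitely generated left `Λ`-modules of finite projective dimension. -/
def FinitisticDimFinite : Prop :=
  ∃ B : ℕ, ∀ (M : Type u) (_ : AddCommGroup M) (_ : Module Λ M),
    Module.Finite Λ M → (∃ k, projDimLE Λ M k) → projDimLE Λ M B

section Homological

open CategoryTheory

variable {Λ : Type u} [Ring Λ] {K P M N : Type u} [AddCommGroup K] [Module Λ K]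
  [AddCommGroup P] [Module Λ P] [AddCommGroup M] [Module Λ M] [AddCommGroup N] [Module Λ N]

theorem projDimLE.mono {k l : ℕ} (h : projDimLE Λ M k) (hkl : k ≤ l) : projDimLE Λ M l := by
  obtain ⟨P, i₁, i₂, d, aug, hP, hs, he, hd, h0⟩ := h
  exact ⟨P, i₁, i₂, d, aug, hP, hs, he, hd, fun j hj => h0 j (hkl.trans_lt hj)⟩

theorem projDimLE_zero_of_projective [Module.Projective Λ M] : projDimLE Λ M 0 := by
  refine ⟨fun j => Nat.casesOn j M fun _ => PUnit.{u + 1},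
    fun j => Nat.casesOn j (inferInstanceAs (AddCommGroup M)) fun _ =>
      inferInstanceAs (AddCommGroup PUnit.{u + 1}),
    fun j => Nat.casesOn j (inferInstanceAs (Module Λ M)) fun _ => PUnit.module,
    fun j => 0, (LinearMap.id : M →ₗ[Λ] M), fun j => ?_, fun x => ⟨x, rfl⟩, fun x => ?_,
    fun j x => ?_, fun j hj => ?_⟩
  · cases j with
    | zero => exact inferInstanceAs (Module.Projective Λ M)
    | succ j => exact inferInstanceAs (Module.Projective Λ PUnit.{u + 1})
  · simp only [Set.mem_range, LinearMap.zero_apply, exists_const]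
    exact eq_comm
  · exact ⟨fun _ => ⟨0, rfl⟩, fun _ => rfl⟩
  · cases j with
    | zero => exact absurd hj (lt_irrefl _)
    | succ j => exact inferInstanceAs (Subsingleton PUnit.{u + 1})

theorem projective_of_projDimLE_zero (h : projDimLE Λ M 0) : Module.Projective Λ M := by
  obtain ⟨P, i₁, i₂, d, aug, hP, hs, he, -, h0⟩ := h
  have := hP 0
  have := h0 1 one_pos
  have hinj : Function.Injective aug := by
    refine (injective_iff_map_eq_zero aug).2 fun x hx => ?_
    obtain ⟨y, rfl⟩ := (he x).1 hx
    rw [Subsingleton.elim y 0, map_zero]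
  exact Module.Projective.of_equiv (LinearEquiv.ofBijective aug ⟨hinj, hs⟩)

/-- Splicing a projective presentation with a resolution of its kernel. -/
theorem projDimLE_succ_of_exact [Module.Projective Λ P] {i : K →ₗ[Λ] P} {f : P →ₗ[Λ] M}
    (hi : Function.Injective i) (hf : Function.Surjective f) (hif : Function.Exact i f) {k : ℕ}
    (hK : projDimLE Λ K k) : projDimLE Λ M (k + 1) := by
  obtain ⟨Q, i₁, i₂, d, aug, hQ, hs, he, hd, h0⟩ := hK
  refine ⟨fun j => Nat.casesOn j P fun j => Q j,
    fun j => Nat.casesOn j (inferInstanceAs (AddCommGroup P)) fun j => i₁ j,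
    fun j => Nat.casesOn j (inferInstanceAs (Module Λ P)) fun j => i₂ j,
    fun j => Nat.casesOn j (i ∘ₗ aug) fun j => d j, f, fun j => ?_, hf, fun x => ?_,
    fun j => ?_, fun j hj => ?_⟩
  · cases j with
    | zero => exact inferInstanceAs (Module.Projective Λ P)
    | succ j => exact hQ j
  · refine (hif x).trans ⟨?_, ?_⟩
    · rintro ⟨y, rfl⟩
      obtain ⟨z, rfl⟩ := hs y
      exact ⟨z, rfl⟩
    · rintro ⟨z, rfl⟩
      exact ⟨aug z, rfl⟩
  · cases j with
    | zero =>
      intro x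
      refine Iff.trans ?_ (he x)
      exact map_eq_zero_iff i hi
    | succ j => exact hd j
  · cases j with
    | zero => exact absurd hj (Nat.not_lt_zero _)
    | succ j => exact h0 j (Nat.lt_of_succ_lt_succ hj)

theorem exists_exact_of_projDimLE_succ {k : ℕ} (h : projDimLE Λ M (k + 1)) :
    ∃ (P : Type u) (_ : AddCommGroup P) (_ : Module Λ P) (f : P →ₗ[Λ] M),
      Module.Projective Λ P ∧ Function.Surjective f ∧ projDimLE Λ f.ker k := by
  obtain ⟨P, i₁, i₂, d, aug, hP, hs, he, hd, h0⟩ := h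
  refine ⟨P 0, i₁ 0, i₂ 0, aug, hP 0, hs, fun j => P (j + 1), fun j => i₁ _, fun j => i₂ _,
    fun j => d (j + 1), (d 0).codRestrict _ fun x => (he _).2 ⟨x, rfl⟩, fun j => hP _, ?_, ?_,
    fun j => hd _, fun j hj => h0 _ (Nat.succ_lt_succ hj)⟩
  · rintro ⟨x, hx⟩
    obtain ⟨y, rfl⟩ := (he x).1 hx
    exact ⟨y, rfl⟩
  · intro x
    rw [← hd 0 x]
    exact Subtype.ext_iff

theorem shortExact_of_exact {i : K →ₗ[Λ] P} {f : P →ₗ[Λ] M}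
    (hi : Function.Injective i) (hf : Function.Surjective f) (hif : Function.Exact i f) :
    (ShortComplex.mk (ModuleCat.ofHom i) (ModuleCat.ofHom f)
      (by ext x; exact hif.apply_apply_eq_zero x)).ShortExact where
  exact := (ShortComplex.ShortExact.moduleCat_exact_iff_function_exact _).2 hif
  mono_f := (ModuleCat.mono_iff_injective _).2 hi
  epi_g := (ModuleCat.epi_iff_surjective _).2 hf

theorem shortExact_ker (f : P →ₗ[Λ] M) (hf : Function.Surjective f) :
    (ShortComplex.mk (ModuleCat.ofHom f.ker.subtype) (ModuleCat.ofHom f)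
      (by ext x; exact f.exact_subtype_ker_map.apply_apply_eq_zero x)).ShortExact :=
  shortExact_of_exact f.ker.injective_subtype hf f.exact_subtype_ker_map

theorem projDimLE_iff_hasProjectiveDimensionLE (k : ℕ) :
    projDimLE Λ M k ↔ HasProjectiveDimensionLE (ModuleCat.of Λ M) k := by
  induction k generalizing M with
  | zero =>
    rw [← projective_iff_hasProjectiveDimensionLE_zero, ← IsProjective.iff_projective]
    exact ⟨projective_of_projDimLE_zero, fun _ => projDimLE_zero_of_projective⟩
  | succ k ih =>
    constructor
    · intro h
      obtain ⟨P, _, _, f, hP, hf, hk⟩ := exists_exact_of_projDimLE_succ h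
      have hP' := (IsProjective.iff_projective (R := Λ) P).1 hP
      exact ((shortExact_ker f hf).hasProjectiveDimensionLT_X₃_iff k hP').2 (ih.1 hk)
    · intro h
      let f : (M →₀ Λ) →ₗ[Λ] M := Finsupp.linearCombination Λ id
      have hf : Function.Surjective f := Finsupp.linearCombination_id_surjective Λ M
      have hP' := (IsProjective.iff_projective (R := Λ) (M →₀ Λ)).1 inferInstance
      exact projDimLE_succ_of_exact f.ker.injective_subtype hf f.exact_subtype_ker_map
        (ih.2 (((shortExact_ker f hf).hasProjectiveDimensionLT_X₃_iff k hP').1 h))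

theorem projDimLE_kernel [Module.Projective Λ P] {i : K →ₗ[Λ] P} {f : P →ₗ[Λ] M}
    (hi : Function.Injective i) (hf : Function.Surjective f) (hif : Function.Exact i f) {k : ℕ}
    (hM : projDimLE Λ M (k + 1)) : projDimLE Λ K k := by
  rw [projDimLE_iff_hasProjectiveDimensionLE] at hM ⊢
  have hP := (IsProjective.iff_projective (R := Λ) P).1 inferInstance
  exact ((shortExact_of_exact hi hf hif).hasProjectiveDimensionLT_X₃_iff k hP).1 hM

theorem projDimLE_of_retract (i : M →ₗ[Λ] N) (r : N →ₗ[Λ] M) (hri : r ∘ₗ i = LinearMap.id)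
    {k : ℕ} (hN : projDimLE Λ N k) : projDimLE Λ M k := by
  rw [projDimLE_iff_hasProjectiveDimensionLE] at hN ⊢
  have e : Retract (ModuleCat.of Λ M) (ModuleCat.of Λ N) :=
    { i := ModuleCat.ofHom i
      r := ModuleCat.ofHom r
      retract := by rw [← ModuleCat.ofHom_comp, hri]; rfl }
  exact e.hasProjectiveDimensionLT _

end Homological

section Truncated

variable {R n}

theorem tgen_pow_eq_zero : tgen R n ^ n = 0 := by
  rw [tgen, ← map_pow, truncMk, RingQuot.mkRingHom_rel (r := truncRel R n) ⟨rfl, rfl⟩, map_zero]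

theorem commute_tgen_truncC (r : R) : Commute (tgen R n) (truncC R n r) := by
  rw [tgen, truncC, RingHom.comp_apply]
  exact (Polynomial.commute_X _).map (truncMk R n)

theorem truncMk_induction {p : TruncPoly R n → Prop} (hadd : ∀ a b, p a → p b → p (a + b))
    (hmul : ∀ r k, p (truncC R n r * tgen R n ^ k)) (s : TruncPoly R n) : p s := by
  obtain ⟨q, rfl⟩ := RingQuot.mkRingHom_surjective (truncRel R n) s
  induction q using Polynomial.induction_on' with
  | add a b ha hb => rw [map_add]; exact hadd _ _ ha hb
  | monomial k a =>
    rw [← Polynomial.C_mul_X_pow_eq_monomial, map_mul, map_pow]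
    exact hmul a k

variable (R n) in
/-- The `R`-module structure of a module over `R[t]/(t^n)` is the one restricted along
`R → R[t]/(t^n)`. -/
class IsRestriction (M : Type u) [AddCommGroup M] [Module R M] [Module (TruncPoly R n) M] :
    Prop where
  truncC_smul : ∀ (r : R) (m : M), truncC R n r • m = r • m

variable {M F : Type u} [AddCommGroup M] [Module R M] [Module (TruncPoly R n) M]
  [IsRestriction R n M] [AddCommGroup F] [Module R F]

/-- An `R`-linear map commuting with `t` is linear over `R[t]/(t^n)`. -/
def extendLinear {N : Type u} [AddCommGroup N] [Module R N] [Module (TruncPoly R n) N]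
    [IsRestriction R n N] (f : M →ₗ[R] N) (ht : ∀ m, f (tgen R n • m) = tgen R n • f m) :
    M →ₗ[TruncPoly R n] N where
  toFun := f
  map_add' := f.map_add
  map_smul' s m := by
    rw [RingHom.id_apply]
    induction s using truncMk_induction with
    | hadd a b ha hb => rw [add_smul, map_add, ha, hb, add_smul]
    | hmul r k =>
      rw [mul_smul, mul_smul, IsRestriction.truncC_smul, IsRestriction.truncC_smul, map_smul]
      congr 1
      induction k with
      | zero => simp
      | succ k ih => rw [pow_succ', mul_smul, mul_smul, ht, ih]

/-- A linear map over `R[t]/(t^n)` is `R`-linear. -/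
def restrictLinear {N : Type u} [AddCommGroup N] [Module R N] [Module (TruncPoly R n) N]
    [IsRestriction R n N] (f : M →ₗ[TruncPoly R n] N) : M →ₗ[R] N where
  toFun := f
  map_add' := f.map_add
  map_smul' r m := by
    rw [RingHom.id_apply, ← IsRestriction.truncC_smul (n := n), map_smul,
      IsRestriction.truncC_smul]

theorem tgen_smul_smul (k : ℕ) (r : R) (m : M) :
    tgen R n ^ k • r • m = r • tgen R n ^ k • m := by
  rw [← IsRestriction.truncC_smul (n := n) r m, ← IsRestriction.truncC_smul (n := n) r (_ • m),
    ← mul_smul, ← mul_smul, ((commute_tgen_truncC r).pow_left k).eq]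

variable (R n) in
/-- The module over `R[t]/(t^n)` induced, equivalently coinduced, from an `R`-module `F`: the
`R`-module `F^n` on which `t` acts by shifting the coordinates. -/
def ShiftModule (F : Type u) : Type u := Fin n → F

namespace ShiftModule

instance : AddCommGroup (ShiftModule n F) := inferInstanceAs (AddCommGroup (Fin n → F))

instance : Module R (ShiftModule n F) := inferInstanceAs (Module R (Fin n → F))

variable (n F) in
/-- The action of `t`. -/
def shift : AddMonoid.End (Fin n → F) where
  toFun f i := if h : i.1 + 1 < n then f ⟨i + 1, h⟩ else 0
  map_zero' := by funext i; simp
  map_add' f g := by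
    funext i
    simp only [Pi.add_apply]
    split_ifs
    · rfl
    · rw [add_zero]

theorem shift_apply (f : Fin n → F) (i : Fin n) :
    shift n F f i = if h : i.1 + 1 < n then f ⟨i + 1, h⟩ else 0 := rfl

theorem shift_pow_apply (k : ℕ) (f : Fin n → F) (i : Fin n) :
    (shift n F ^ k) f i = if h : i.1 + k < n then f ⟨i + k, h⟩ else 0 := by
  induction k generalizing i with
  | zero => simp
  | succ k ih =>
    rw [pow_succ', AddMonoid.End.coe_mul, Function.comp_apply, shift_apply]
    simp only [ih, ← add_assoc, add_right_comm _ k 1]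
    split_ifs <;> first | rfl | omega

theorem commute_toAddMonoidEnd_shift (r : R) :
    Commute (Module.toAddMonoidEnd R (Fin n → F) r) (shift n F) := by
  refine AddMonoidHom.ext fun f => funext fun i => ?_
  change r • shift n F f i = shift n F (r • f) i
  rw [shift_apply, shift_apply, smul_dite, smul_zero]
  rfl

variable (R n F) in
/-- The action of `R[t]/(t^n)`. -/
def action : TruncPoly R n →+* AddMonoid.End (Fin n → F) :=
  RingQuot.lift
    ⟨Polynomial.eval₂RingHom' (Module.toAddMonoidEnd R (Fin n → F)) (shift n F)
      commute_toAddMonoidEnd_shift, by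
      rintro _ _ ⟨rfl, rfl⟩
      rw [map_zero]
      refine AddMonoidHom.ext fun f => funext fun i => ?_
      refine (congrArg (fun φ : AddMonoid.End (Fin n → F) => φ f i)
        (Polynomial.eval₂_X_pow (Module.toAddMonoidEnd R (Fin n → F)) (shift n F))).trans ?_
      exact (shift_pow_apply n f i).trans (dif_neg (by omega))⟩

instance : Module (TruncPoly R n) (ShiftModule n F) :=
  letI : Module (TruncPoly R n) (Fin n → F) := Module.compHom (Fin n → F) (action R n F)
  inferInstanceAs (Module (TruncPoly R n) (Fin n → F))

theorem truncMk_smul (p : R[X]) (f : ShiftModule n F) : truncMk R n p • f =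
    p.eval₂ (Module.toAddMonoidEnd R (Fin n → F)) (shift n F) f :=
  congrArg (fun φ : AddMonoid.End (Fin n → F) => φ f) (RingQuot.lift_mkRingHom_apply _ _ p)

instance : IsRestriction R n (ShiftModule n F) where
  truncC_smul r f := by
    rw [truncC, RingHom.comp_apply, truncMk_smul, Polynomial.eval₂_C]
    rfl

theorem tgen_pow_smul_apply (k : ℕ) (f : ShiftModule n F) (i : Fin n) :
    (tgen R n ^ k • f) i = if h : i.1 + k < n then f ⟨i + k, h⟩ else 0 := by
  rw [tgen, ← map_pow, truncMk_smul, Polynomial.eval₂_X_pow]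
  exact shift_pow_apply k f i

theorem tgen_smul_apply (f : ShiftModule n F) (i : Fin n) :
    (tgen R n • f) i = if h : i.1 + 1 < n then f ⟨i + 1, h⟩ else 0 := by
  simpa using tgen_pow_smul_apply (R := R) 1 f i

/-- The map `m ↦ (φ (t ^ i • m))ᵢ` corresponding to `φ` under coinduction. -/
def coindLift (φ : M →ₗ[R] F) : M →ₗ[TruncPoly R n] ShiftModule n F :=
  extendLinear
    { toFun := fun m i => φ (tgen R n ^ i.1 • m)
      map_add' := fun a b => funext fun i => by rw [smul_add, map_add]; rfl
      map_smul' := fun r a => funext fun i => by rw [tgen_smul_smul, map_smul]; rfl }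
    fun m => funext fun i => by
      rw [tgen_smul_apply]
      change φ (_ • _ • m) = _
      rw [← mul_smul, ← pow_succ]
      split_ifs with h
      · rfl
      · rw [show i.1 + 1 = n by omega, tgen_pow_eq_zero, zero_smul, map_zero]

theorem coindLift_apply (φ : M →ₗ[R] F) (m : M) (i : Fin n) :
    coindLift φ m i = φ (tgen R n ^ i.1 • m) := rfl

/-- The map `f ↦ ∑ t ^ (n - 1 - i) • φ (f i)` corresponding to `φ` under induction. -/
def indLift (φ : F →ₗ[R] M) : ShiftModule n F →ₗ[TruncPoly R n] M :=
  extendLinear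
    { toFun := fun f => ∑ i : Fin n, tgen R n ^ (n - 1 - i.1) • φ (f i)
      map_add' := fun f g => by
        rw [← Finset.sum_add_distrib]
        refine Finset.sum_congr rfl fun i _ => ?_
        rw [← smul_add, ← map_add]; rfl
      map_smul' := fun r f => by
        rw [RingHom.id_apply, Finset.smul_sum]
        refine Finset.sum_congr rfl fun i _ => ?_
        rw [← tgen_smul_smul, ← map_smul φ]; rfl }
    fun f => by
      change ∑ i : Fin n, _ = _ • ∑ i : Fin n, _
      simp only [tgen_smul_apply, Finset.smul_sum, ← mul_smul, ← pow_succ']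
      cases n with
      | zero => rfl
      | succ m =>
        rw [Fin.sum_univ_castSucc, Fin.sum_univ_succ]
        simp only [Fin.val_last, lt_irrefl, dite_false, map_zero, smul_zero, add_zero,
          Fin.val_zero, Nat.add_sub_cancel, Nat.sub_zero, tgen_pow_eq_zero, zero_smul, zero_add]
        refine Finset.sum_congr rfl fun i _ => ?_
        rw [dif_pos (by simp)]
        congr 2
        simp only [Fin.val_castSucc, Fin.val_succ]
        omega

theorem indLift_apply (φ : F →ₗ[R] M) (f : ShiftModule n F) :
    indLift (n := n) φ f = ∑ i : Fin n, tgen R n ^ (n - 1 - i.1) • φ (f i) := rfl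

section Coordinates

variable [NeZero n]

variable (R n F) in
/-- The inclusion of the generating coordinate. -/
def last : F →ₗ[R] ShiftModule n F := LinearMap.single R (fun _ : Fin n => F) (Fin.rev 0)

variable (R n F) in
/-- The projection on the cogenerating coordinate. -/
def head : ShiftModule n F →ₗ[R] F := LinearMap.proj (R := R) (φ := fun _ : Fin n => F) 0

theorem indLift_last (φ : F →ₗ[R] M) (x : F) : indLift (n := n) φ (last R n F x) = φ x := by
  rw [indLift_apply, Finset.sum_eq_single (Fin.rev 0)]
  · change _ • φ (Pi.single (M := fun _ : Fin n => F) _ x _) = _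
    rw [Pi.single_eq_same]
    simp
  · intro i _ hi
    change _ • φ (Pi.single (M := fun _ : Fin n => F) _ x _) = _
    rw [Pi.single_eq_of_ne hi, map_zero, smul_zero]
  · simp

theorem head_coindLift (φ : M →ₗ[R] F) (m : M) : head R n F (coindLift φ m) = φ m := by
  change φ (tgen R n ^ ((0 : Fin n) : ℕ) • m) = _
  simp

theorem head_tgen_pow_smul (f : ShiftModule n F) (i : Fin n) :
    head R n F (tgen R n ^ i.1 • f) = f i := by
  change (tgen R n ^ i.1 • f) 0 = _
  rw [tgen_pow_smul_apply, dif_pos (by simp)]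
  congr 1
  ext
  simp

end Coordinates

/-- The functoriality of `ShiftModule`. -/
def map {F' : Type u} [AddCommGroup F'] [Module R F'] (g : F →ₗ[R] F') :
    ShiftModule n F →ₗ[TruncPoly R n] ShiftModule n F' :=
  extendLinear (M := ShiftModule n F) (N := ShiftModule n F')
    { toFun := fun f i => g (f i)
      map_add' := fun a b => funext fun i => g.map_add (a i) (b i)
      map_smul' := fun r a => funext fun i => g.map_smul r (a i) } fun f => funext fun i => by
      rw [tgen_smul_apply]
      change g ((tgen R n • f) i) = _
      rw [tgen_smul_apply]
      split_ifs
      · rfl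
      · exact map_zero g

end ShiftModule

end Truncated

section Main

open ShiftModule

variable {R n}

theorem ShiftModule.exact_map {F G H : Type u} [AddCommGroup F] [Module R F] [AddCommGroup G]
    [Module R G] [AddCommGroup H] [Module R H] {f : F →ₗ[R] G} {g : G →ₗ[R] H}
    (h : Function.Exact f g) : Function.Exact (map (n := n) f) (map (n := n) g) := by
  refine fun y => ⟨fun hy => ?_, ?_⟩
  · choose x hx using fun i => (h (y i)).1 (congrFun hy i)
    exact ⟨x, funext hx⟩
  · rintro ⟨x, rfl⟩
    exact funext fun i => h.apply_apply_eq_zero (x i)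

theorem finite_shiftModule {M : Type u} [AddCommGroup M] [Module R M] [Module.Finite R M] :
    Module.Finite (TruncPoly R n) (ShiftModule n M) := by
  let : Module R (TruncPoly R n) := Module.compHom _ (truncC R n)
  have : IsScalarTower R (TruncPoly R n) (ShiftModule n M) := ⟨fun r s m =>
    (mul_smul (truncC R n r) s m).trans (IsRestriction.truncC_smul r (s • m))⟩
  have : Module.Finite R (ShiftModule n M) := inferInstanceAs (Module.Finite R (Fin n → M))
  exact Module.Finite.of_restrictScalars_finite R (TruncPoly R n) _

variable [NeZero n]

theorem indLift_surjective {M : Type u} [AddCommGroup M] [Module R M]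
    [Module (TruncPoly R n) M] [IsRestriction R n M] :
    Function.Surjective (indLift (n := n) (LinearMap.id : M →ₗ[R] M)) :=
  fun x => ⟨last R n M x, indLift_last _ x⟩

theorem indLift_last_eq_self {F : Type u} [AddCommGroup F] [Module R F] (x : ShiftModule n F) :
    indLift (n := n) (last R n F) x = x := by
  funext k
  have hlast (y : F) (j : Fin n) : last R n F y j = if j = Fin.rev 0 then y else 0 :=
    Pi.single_apply (Fin.rev 0) y j
  let e : ShiftModule n F →+ F := Pi.evalAddMonoidHom (fun _ : Fin n => F) k
  change e (indLift (n := n) (last R n F) x) = _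
  rw [indLift_apply, map_sum]
  change ∑ i : Fin n, (tgen R n ^ (n - 1 - i.1) • last R n F (x i)) k = _
  rw [Finset.sum_eq_single k]
  · rw [tgen_pow_smul_apply, dif_pos (by omega), hlast, if_pos]
    ext
    simp
    omega
  · intro i _ hi
    rw [tgen_pow_smul_apply]
    split_ifs
    · rw [hlast, if_neg]
      intro h
      have := congrArg Fin.val h
      simp at this
      exact hi (by ext; omega)
    · rfl
  · simp

/-- Induction preserves projectivity. -/
theorem projective_shiftModule {P : Type u} [AddCommGroup P] [Module R P]
    [Module.Projective R P] : Module.Projective (TruncPoly R n) (ShiftModule n P) := by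
  refine Module.Projective.of_lifting_property fun {X Y} _ _ _ _ f g hf => ?_
  let : Module R X := Module.compHom _ (truncC R n)
  have : IsRestriction R n X := ⟨fun _ _ => rfl⟩
  let : Module R Y := Module.compHom _ (truncC R n)
  have : IsRestriction R n Y := ⟨fun _ _ => rfl⟩
  obtain ⟨h, hh⟩ := Module.projective_lifting_property (restrictLinear f)
    (restrictLinear g ∘ₗ last R n P) hf
  refine ⟨indLift h, LinearMap.ext fun x => ?_⟩
  conv_rhs => rw [← indLift_last_eq_self (R := R) x]
  rw [LinearMap.comp_apply, indLift_apply, indLift_apply, map_sum, map_sum]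
  refine Finset.sum_congr rfl fun i _ => ?_
  rw [map_smul, map_smul]
  exact congrArg _ (LinearMap.congr_fun hh (x i))

/-- Projective modules over `R[t]/(t^n)` are projective over `R`. -/
theorem projective_restrict {P : Type u} [AddCommGroup P] [Module R P]
    [Module (TruncPoly R n) P] [IsRestriction R n P] [Module.Projective (TruncPoly R n) P] :
    Module.Projective R P := by
  refine Module.Projective.of_lifting_property'' fun f hf => ?_
  obtain ⟨h, hh⟩ := Module.projective_lifting_property (map (n := n) f)
    (coindLift (n := n) (LinearMap.id : P →ₗ[R] P)) fun y => by
      choose x hx using fun i => hf (y i)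
      exact ⟨x, funext hx⟩
  refine ⟨head R n _ ∘ₗ restrictLinear h, LinearMap.ext fun x => ?_⟩
  have := congrArg (head R n P) (LinearMap.congr_fun hh x)
  rwa [head_coindLift] at this

/-- An injection into a projective module which splits over `R` splits over `R[t]/(t^n)`. -/
theorem exists_retraction {K P : Type u} [AddCommGroup K] [Module R K]
    [Module (TruncPoly R n) K] [IsRestriction R n K] [Module.Projective (TruncPoly R n) K]
    [AddCommGroup P] [Module R P] [Module (TruncPoly R n) P] [IsRestriction R n P]
    (i : K →ₗ[TruncPoly R n] P) (ρ : P →ₗ[R] K) (hρ : ∀ x, ρ (i x) = x) :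
    ∃ r : P →ₗ[TruncPoly R n] K, r ∘ₗ i = LinearMap.id := by
  obtain ⟨j, hj⟩ := Module.projective_lifting_property
    (indLift (n := n) (LinearMap.id : K →ₗ[R] K)) LinearMap.id indLift_surjective
  refine ⟨indLift LinearMap.id ∘ₗ coindLift (head R n K ∘ₗ restrictLinear j ∘ₗ ρ),
    LinearMap.ext fun x => ?_⟩
  have key : coindLift (head R n K ∘ₗ restrictLinear j ∘ₗ ρ) (i x) = j x := by
    funext k
    rw [coindLift_apply, ← map_smul, ← head_tgen_pow_smul (R := R) (j x) k, ← map_smul]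
    exact congrArg (fun y => head R n K (j y)) (hρ _)
  rw [LinearMap.comp_apply, LinearMap.comp_apply, key]
  exact LinearMap.congr_fun hj x

theorem projective_of_exact {K P M : Type u} [AddCommGroup K] [Module R K]
    [Module (TruncPoly R n) K] [IsRestriction R n K] [Module.Projective (TruncPoly R n) K]
    [AddCommGroup P] [Module R P] [Module (TruncPoly R n) P] [IsRestriction R n P]
    [Module.Projective (TruncPoly R n) P]
    [AddCommGroup M] [Module R M] [Module (TruncPoly R n) M] [IsRestriction R n M]
    [Module.Projective R M]
    {i : K →ₗ[TruncPoly R n] P} {f : P →ₗ[TruncPoly R n] M}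
    (hi : Function.Injective i) (hf : Function.Surjective f) (hif : Function.Exact i f) :
    Module.Projective (TruncPoly R n) M := by
  have hs := Module.projective_lifting_property (restrictLinear f) (LinearMap.id : M →ₗ[R] M) hf
  have hif' : Function.Exact (restrictLinear i) (restrictLinear f) := hif
  obtain ⟨ρ, hρ⟩ := ((hif'.split_tfae hi hf).out 0 1 rfl rfl).1 hs
  obtain ⟨s, hs⟩ := ((hif.split_tfae hi hf).out 0 1 rfl rfl).2
    (exists_retraction i ρ (LinearMap.congr_fun hρ))
  exact Module.Projective.of_split s f hs

/-- Restriction to `R` preserves bounds on the projective dimension. -/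
theorem projDimLE_restrict {M : Type u} [AddCommGroup M] [Module R M]
    [Module (TruncPoly R n) M] [IsRestriction R n M] {k : ℕ}
    (h : projDimLE (TruncPoly R n) M k) : projDimLE R M k := by
  obtain ⟨P, i₁, i₂, d, aug, hP, hs, he, hd, h0⟩ := h
  let (j : ℕ) : Module R (P j) := Module.compHom _ (truncC R n)
  have (j : ℕ) : IsRestriction R n (P j) := ⟨fun _ _ => rfl⟩
  exact ⟨P, i₁, inferInstance, fun j => restrictLinear (d j), restrictLinear aug,
    fun j => projective_restrict (n := n), hs, he, hd, h0⟩

/-- Induction preserves bounds on the projective dimension. -/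
theorem projDimLE_shiftModule {M : Type u} [AddCommGroup M] [Module R M] {k : ℕ}
    (h : projDimLE R M k) : projDimLE (TruncPoly R n) (ShiftModule n M) k := by
  obtain ⟨P, i₁, i₂, d, aug, hP, hs, he, hd, h0⟩ := h
  refine ⟨fun j => ShiftModule n (P j), inferInstance, inferInstance, fun j => map (d j), map aug,
    fun j => projective_shiftModule, fun y => ?_, exact_map he, fun j => exact_map (hd j),
    fun j hj => ?_⟩
  · choose x hx using fun i => hs (y i)
    exact ⟨x, funext hx⟩
  · have := h0 j hj
    exact inferInstanceAs (Subsingleton (Fin n → P j))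

/-- A module over `R[t]/(t^n)` of finite projective dimension that is projective over `R` is
projective. -/
theorem projective_of_projDimLE {M : Type u} [AddCommGroup M] [Module R M]
    [Module (TruncPoly R n) M] [IsRestriction R n M] [Module.Projective R M] {k : ℕ}
    (h : projDimLE (TruncPoly R n) M k) : Module.Projective (TruncPoly R n) M := by
  induction k generalizing M with
  | zero => exact projective_of_projDimLE_zero h
  | succ k ih =>
    obtain ⟨P, _, _, f, hP, hf, hk⟩ := exists_exact_of_projDimLE_succ h
    let : Module R P := Module.compHom _ (truncC R n)
    have : IsRestriction R n P := ⟨fun _ _ => rfl⟩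
    let : Module R f.ker := Module.compHom _ (truncC R n)
    have : IsRestriction R n f.ker := ⟨fun _ _ => rfl⟩
    have := projective_restrict (R := R) (n := n) (P := P)
    have : Module.Projective R f.ker :=
      projective_of_projDimLE_zero <| projDimLE_kernel (i := restrictLinear f.ker.subtype)
        (f := restrictLinear f) f.ker.injective_subtype hf f.exact_subtype_ker_map
        (projDimLE_zero_of_projective.mono zero_le_one)
    have := ih hk
    exact projective_of_exact f.ker.injective_subtype hf f.exact_subtype_ker_map

/-- Over modules of finite projective dimension over `R[t]/(t^n)`, bounds on the projective
dimension over `R` also hold over `R[t]/(t^n)`. -/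
theorem projDimLE_of_restrict {M : Type u} [AddCommGroup M] [Module R M]
    [Module (TruncPoly R n) M] [IsRestriction R n M] {k b : ℕ}
    (h : projDimLE (TruncPoly R n) M k) (hb : projDimLE R M b) :
    projDimLE (TruncPoly R n) M b := by
  induction b generalizing M with
  | zero =>
    have := projective_of_projDimLE_zero hb
    have := projective_of_projDimLE h
    exact projDimLE_zero_of_projective
  | succ b ih =>
    obtain ⟨P, _, _, f, hP, hf, hk⟩ := exists_exact_of_projDimLE_succ (h.mono k.le_succ)
    let : Module R P := Module.compHom _ (truncC R n)
    have : IsRestriction R n P := ⟨fun _ _ => rfl⟩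
    let : Module R f.ker := Module.compHom _ (truncC R n)
    have : IsRestriction R n f.ker := ⟨fun _ _ => rfl⟩
    have := projective_restrict (R := R) (n := n) (P := P)
    exact projDimLE_succ_of_exact f.ker.injective_subtype hf f.exact_subtype_ker_map <| ih hk <|
      projDimLE_kernel (i := restrictLinear f.ker.subtype) (f := restrictLinear f)
        f.ker.injective_subtype hf f.exact_subtype_ker_map hb

theorem finite_restrict {M : Type u} [AddCommGroup M] [Module R M] [Module (TruncPoly R n) M]
    [IsRestriction R n M] [Module.Finite (TruncPoly R n) M] : Module.Finite R M := by
  let : Module R (TruncPoly R n) := Module.compHom _ (truncC R n)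
  have : IsRestriction R n (TruncPoly R n) := ⟨fun _ _ => rfl⟩
  have : IsScalarTower R (TruncPoly R n) M := ⟨fun r s m =>
    (mul_smul (truncC R n r) s m).trans (IsRestriction.truncC_smul r (s • m))⟩
  let φ : R →ₗ[R] TruncPoly R n := LinearMap.toSpanSingleton R _ 1
  have : Module.Finite R (ShiftModule n R) := inferInstanceAs (Module.Finite R (Fin n → R))
  have : Module.Finite R (TruncPoly R n) :=
    Module.Finite.of_surjective (restrictLinear (indLift (n := n) φ)) fun s =>
      ⟨s • last R n R 1, by
        change indLift φ (s • last R n R 1) = s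
        rw [map_smul, indLift_last]
        simp [φ]⟩
  exact Module.Finite.trans (TruncPoly R n) M

theorem finitisticDimFinite_truncPoly_iff :
    FinitisticDimFinite (TruncPoly R n) ↔ FinitisticDimFinite R := by
  refine ⟨fun ⟨b, hb⟩ => ⟨b, fun M _ _ _ ⟨k, hk⟩ => ?_⟩,
    fun ⟨b, hb⟩ => ⟨b, fun M _ _ _ ⟨k, hk⟩ => ?_⟩⟩
  · have h := hb (ShiftModule n M) inferInstance inferInstance finite_shiftModule ⟨k, projDimLE_shiftModule hk⟩
    let i : M →ₗ[R] ShiftModule n M := LinearMap.single R (fun _ : Fin n => M) 0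
    exact projDimLE_of_retract i (head R n M)
      (LinearMap.proj_comp_single_same R (fun _ : Fin n => M) 0)
      (projDimLE_restrict (n := n) (M := ShiftModule n M) h)
  · let : Module R M := Module.compHom _ (truncC R n)
    have : IsRestriction R n M := ⟨fun _ _ => rfl⟩
    exact projDimLE_of_restrict hk
      (hb M _ _ (finite_restrict (n := n)) ⟨k, projDimLE_restrict hk⟩)

end Main

/-- **Statement 13.** Let `R` be an Artin algebra (finitely generated as a module over a
commutative Artinian ring `C` acting centrally) and `n ≥ 2`. Then the finitistic dimension of
`R` is finite iff the finitistic dimension of `R[t]/(t^n)` is finite, i.e. `R` satisfies the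
Finitistic Dimension Conjecture iff `R[t]/(t^n)` does. -/
theorem statement13 (R : Type u) [Ring R] (C : Type u) [CommRing C] [IsArtinianRing C]
    [Algebra C R] (hfg : Module.Finite C R) (n : ℕ) (hn : 2 ≤ n) :
    FinitisticDimFinite R ↔ FinitisticDimFinite (TruncPoly R n) := by
  have : NeZero n := ⟨by omega⟩
  exact finitisticDimFinite_truncPoly_iff.symm

end Paper
end
end

section
/- Let R be an Artin algebra and n ≥ 2. Then R satisfies the Gorenstein Symmetry Conjecture if and only if R[t]/(t^n) does; that is, the injective dimension of R as a left R-module is finite exactly when the injective dimension of R as a right R-module is finite, if and only if the injective dimension of R[t]/(t^n) as a left module over itself is finite exactly when its injective dimension as a right module over itself is finite. -/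
noncomputable section

namespace Paper

universe u

open Polynomial

variable (R : Type u) [Ring R] (n : ℕ)

section InjectiveDimension

open CategoryTheory

variable {Λ : Type u} [Ring Λ]

theorem injDimLE.of_linearEquiv {M N : Type u} [AddCommGroup M] [Module Λ M] [AddCommGroup N]
    [Module Λ N] (e : M ≃ₗ[Λ] N) {m : ℕ} (h : injDimLE Λ N m) : injDimLE Λ M m := by
  obtain ⟨I, _, _, d, aug, hI, haug, h0, hd, hm⟩ := h
  refine ⟨I, _, _, d, aug ∘ₗ e.toLinearMap, hI, haug.comp e.injective, fun x => ?_, hd, hm⟩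
  rw [h0 x]
  constructor
  · rintro ⟨y, rfl⟩
    exact ⟨e.symm y, by simp⟩
  · rintro ⟨y, rfl⟩
    exact ⟨e y, rfl⟩

/-- Prepend an object to a sequence of modules. -/
def consObj (A : ModuleCat.{u} Λ) (I : ℕ → ModuleCat.{u} Λ) : ℕ → ModuleCat.{u} Λ
  | 0 => A
  | j + 1 => I j

/-- Prepend a map to a sequence of linear maps. -/
def consMap (A : ModuleCat.{u} Λ) (I : ℕ → ModuleCat.{u} Λ) (a : A →ₗ[Λ] I 0)
    (d : ∀ j, I j →ₗ[Λ] I (j + 1)) : ∀ j, consObj A I j →ₗ[Λ] consObj A I (j + 1)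
  | 0 => a
  | j + 1 => d j

theorem injDimLE_zero_of_injective (M : Type u) [AddCommGroup M] [Module Λ M]
    (hM : Module.Injective Λ M) : injDimLE Λ M 0 := by
  have hP : Module.Injective Λ PUnit.{u + 1} := ⟨fun _ _ _ _ _ _ _ _ _ => ⟨0, fun _ => rfl⟩⟩
  let I := consObj (ModuleCat.of Λ M) (fun _ => ModuleCat.of Λ PUnit.{u + 1})
  refine ⟨fun j => I j, fun j => inferInstance, fun j => inferInstance,
    consMap _ _ 0 (fun _ => 0), LinearMap.id, ?_, Function.injective_id, ?_, ?_, ?_⟩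
  · rintro (_ | j)
    · exact hM
    · exact hP
  · intro x
    exact ⟨fun _ => ⟨x, rfl⟩, fun _ => rfl⟩
  · intro j x
    refine ⟨fun _ => ⟨0, ?_⟩, fun _ => ?_⟩
    · exact Subsingleton.elim (α := PUnit.{u + 1}) _ _
    · exact Subsingleton.elim (α := PUnit.{u + 1}) _ _
  · rintro (_ | j) hj
    · omega
    · exact inferInstanceAs (Subsingleton PUnit.{u + 1})

theorem injDimLE_succ_of_exact {M A Q : Type u} [AddCommGroup M] [Module Λ M] [AddCommGroup A]
    [Module Λ A] [AddCommGroup Q] [Module Λ Q] (i : M →ₗ[Λ] A) (p : A →ₗ[Λ] Q)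
    (hA : Module.Injective Λ A) (hi : Function.Injective i) (hp : Function.Surjective p)
    (hip : Function.Exact i p) {m : ℕ} (hQ : injDimLE Λ Q m) : injDimLE Λ M (m + 1) := by
  obtain ⟨I, _, _, d, aug, hI, haug, h0, hd, hm⟩ := hQ
  let J := consObj (ModuleCat.of Λ A) (fun j => ModuleCat.of Λ (I j))
  refine ⟨fun j => J j, fun j => inferInstance, fun j => inferInstance,
    consMap (ModuleCat.of Λ A) (fun j => ModuleCat.of Λ (I j)) (aug ∘ₗ p) d, i, ?_, hi, ?_, ?_, ?_⟩
  · rintro (_ | j)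
    · exact hA
    · exact hI j
  · intro x
    refine Iff.trans ?_ (hip x)
    exact map_eq_zero_iff aug haug
  · rintro (_ | j)
    · intro x
      refine (h0 x).trans ⟨?_, ?_⟩
      · rintro ⟨y, rfl⟩
        obtain ⟨z, rfl⟩ := hp y
        exact ⟨z, rfl⟩
      · rintro ⟨z, rfl⟩
        exact ⟨p z, rfl⟩
    · exact hd j
  · rintro (_ | j) hj
    · omega
    · exact hm j (by omega)

theorem hasInjectiveDimensionLT_of_injDimLE (m : ℕ) (M : Type u) [AddCommGroup M] [Module Λ M]
    (h : injDimLE Λ M m) : HasInjectiveDimensionLT (ModuleCat.of Λ M) (m + 1) := by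
  induction m generalizing M with
  | zero =>
    obtain ⟨I, _, _, d, aug, hI, haug, h0, hd, hm⟩ := h
    have := hm 1 one_pos
    have hsurj : Function.Surjective aug := fun x => (h0 x).1 (Subsingleton.elim _ _)
    have e := LinearEquiv.ofBijective aug ⟨haug, hsurj⟩
    have := hI 0
    have := Module.injective_object_of_injective_module Λ (I 0)
    exact hasInjectiveDimensionLT_of_iso e.symm.toModuleIso 1
  | succ m ih =>
    obtain ⟨I, _, _, d, aug, hI, haug, h0, hd, hm⟩ := h
    have hQ : injDimLE Λ (LinearMap.range (d 0)) m := by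
      refine ⟨fun j => I (j + 1), fun j => inferInstance, fun j => inferInstance,
        fun j => d (j + 1), (LinearMap.range (d 0)).subtype, fun j => hI _,
        Subtype.val_injective, fun x => ?_, fun j => hd _, fun j hj => hm _ (by omega)⟩
      simpa using hd 0 x
    have := hI 0
    have := Module.injective_object_of_injective_module Λ (I 0)
    let S : ShortComplex (ModuleCat.{u} Λ) :=
      ShortComplex.mk (ModuleCat.ofHom aug) (ModuleCat.ofHom (d 0).rangeRestrict) (by
        ext x
        exact (h0 _).2 ⟨x, rfl⟩)
    have hS : S.ShortExact := by
      refine ModuleCat.shortComplex_shortExact S (fun x => ?_) haug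
        (LinearMap.surjective_rangeRestrict _)
      exact Subtype.ext_iff.trans (h0 x)
    refine hS.hasInjectiveDimensionLT_X₁ (m + 1) (ih _ hQ) ?_
    exact hasInjectiveDimensionLT_of_ge (ModuleCat.of Λ (I 0)) 1 _ (by omega)

theorem injDimLE_of_hasInjectiveDimensionLT (m : ℕ) (M : Type u) [AddCommGroup M] [Module Λ M]
    (h : HasInjectiveDimensionLT (ModuleCat.of Λ M) (m + 1)) : injDimLE Λ M m := by
  induction m generalizing M with
  | zero =>
    exact injDimLE_zero_of_injective M ((Module.injective_iff_injective_object Λ M).2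
      (injective_iff_hasInjectiveDimensionLT_one.2 h))
  | succ m ih =>
    let ⟨A, hA, i, hi⟩ := EnoughInjectives.presentation (ModuleCat.of Λ M)
    have hi' : Function.Injective i.hom := (ModuleCat.mono_iff_injective i).1 hi
    let p := (LinearMap.range i.hom).mkQ
    have hp : Function.Surjective p := Submodule.mkQ_surjective _
    have hip : Function.Exact i.hom p := LinearMap.exact_map_mkQ_range _
    let S : ShortComplex (ModuleCat.{u} Λ) :=
      ShortComplex.mk i (ModuleCat.ofHom p) (by
        ext x
        exact (hip _).2 ⟨x, rfl⟩)
    have hS : S.ShortExact := ModuleCat.shortComplex_shortExact S hip hi' hp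
    refine injDimLE_succ_of_exact i.hom p ((Module.injective_iff_injective_object Λ A).2 hA)
      hi' hp hip (ih _ ?_)
    exact (hS.hasInjectiveDimensionLT_X₃_iff m hA).2 h

theorem injDimLE.of_retract {M N : Type u} [AddCommGroup M] [Module Λ M] [AddCommGroup N]
    [Module Λ N] (i : M →ₗ[Λ] N) (r : N →ₗ[Λ] M) (hir : ∀ x, r (i x) = x) {m : ℕ}
    (h : injDimLE Λ N m) : injDimLE Λ M m := by
  have := hasInjectiveDimensionLT_of_injDimLE m N h
  refine injDimLE_of_hasInjectiveDimensionLT m M ?_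
  let ρ : Retract (ModuleCat.of Λ M) (ModuleCat.of Λ N) :=
    ⟨ModuleCat.ofHom i, ModuleCat.ofHom r, by ext x; exact hir x⟩
  exact ρ.hasInjectiveDimensionLT _

end InjectiveDimension

section Coinduction

variable {R S : Type u} [Ring R] [Ring S]

/-- The additive group underlying the coinduced module `Hom_R(S, X)`. -/
def Coind (f : R →+* S) (X : Type u) [AddCommGroup X] [Module R X] : AddSubgroup (S →+ X) where
  carrier := {φ | ∀ r s, φ (f r * s) = r • φ s}
  zero_mem' r s := by simp
  add_mem' {φ ψ} hφ hψ r s := by simp [hφ r s, hψ r s]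
  neg_mem' {φ} hφ r s := by simp [hφ r s]

variable {f : R →+* S} {X Y Z : Type u} [AddCommGroup X] [Module R X] [AddCommGroup Y]
  [Module R Y] [AddCommGroup Z] [Module R Z]

namespace Coind

theorem map_mul (φ : Coind f X) (r : R) (s : S) : φ.1 (f r * s) = r • φ.1 s := φ.2 r s

@[ext] theorem ext {φ ψ : Coind f X} (h : ∀ s, φ.1 s = ψ.1 s) : φ = ψ :=
  Subtype.ext (AddMonoidHom.ext h)

instance : SMul S (Coind f X) where
  smul s φ := ⟨φ.1.comp (AddMonoidHom.mulRight s), fun r x => by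
    simpa [mul_assoc] using φ.2 r (x * s)⟩

theorem smul_apply (s : S) (φ : Coind f X) (x : S) : (s • φ).1 x = φ.1 (x * s) := rfl

instance : Module S (Coind f X) where
  one_smul φ := ext fun s => by simp [smul_apply]
  mul_smul a b φ := ext fun s => by simp [smul_apply, mul_assoc]
  smul_zero a := ext fun s => by simp [smul_apply]
  smul_add a φ ψ := ext fun s => by simp [smul_apply]
  add_smul a b φ := ext fun s => by simp [smul_apply, mul_add]
  zero_smul φ := ext fun s => by simp [smul_apply]

/-- Functoriality of coinduction. -/
def map (f : R →+* S) (g : X →ₗ[R] Y) : Coind f X →ₗ[S] Coind f Y where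
  toFun φ := ⟨g.toAddMonoidHom.comp φ.1, fun r s => by simp [φ.2 r s]⟩
  map_add' φ ψ := ext fun s => by simp
  map_smul' a φ := ext fun s => by simp [smul_apply]

theorem map_apply (g : X →ₗ[R] Y) (φ : Coind f X) (s : S) : (map f g φ).1 s = g (φ.1 s) := rfl

theorem map_injective {g : X →ₗ[R] Y} (hg : Function.Injective g) :
    Function.Injective (map f g) := fun φ ψ h => ext fun s => hg <| by
  rw [← map_apply, h, map_apply]

theorem injective (f : R →+* S) (hX : Module.Injective R X) : Module.Injective S (Coind f X) := by
  refine ⟨fun A B _ _ _ _ i hi g => ?_⟩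
  let := Module.compHom A f
  let := Module.compHom B f
  let i' : A →ₗ[R] B :=
    { toFun := i, map_add' := i.map_add, map_smul' := fun r x => i.map_smul (f r) x }
  let g' : A →ₗ[R] X :=
    { toFun := fun a => (g a).1 1
      map_add' := fun a b => by simp
      map_smul' := fun r a => by
        change (g (f r • a)).1 1 = r • (g a).1 1
        rw [g.map_smul, smul_apply, one_mul, ← map_mul, mul_one] }
  obtain ⟨h, hh⟩ := hX.out i' hi g'
  have hsmul : ∀ (r : R) (b : B), h (f r • b) = r • h b := h.map_smul
  refine ⟨
    { toFun := fun b => ⟨⟨⟨fun s => h (s • b), by simp⟩, fun s t => by simp [add_smul]⟩,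
        fun r s => by simpa [mul_smul] using hsmul r (s • b)⟩
      map_add' := fun b c => ext fun s => by simp
      map_smul' := fun a b => ext fun s => by simp [smul_apply, mul_smul] }, fun a => ext fun s => ?_⟩
  change h (s • i a) = (g a).1 s
  rw [← i.map_smul]
  refine (hh (s • a)).trans ?_
  change (g (s • a)).1 1 = (g a).1 s
  rw [g.map_smul, smul_apply, one_mul]

end Coind

end Coinduction

/-- Coefficient functions exhibiting `S` as `R[τ]/(τ^n)`, where `R` maps to `S` via `f`. -/
structure TruncData {R S : Type u} [Ring R] [Ring S] (f : R →+* S) (τ : S) (n : ℕ) where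
  /-- The coefficient of `τ^i`, meaningful for `i < n`. -/
  coeff : ℕ → S →+ R
  central : ∀ s, τ * s = s * τ
  pow_eq_zero : τ ^ n = 0
  sum_coeff : ∀ s, ∑ i ∈ Finset.range n, f (coeff i s) * τ ^ i = s
  coeff_mul : ∀ i r s, coeff i (f r * s) = r * coeff i s
  coeff_mul_right : ∀ i r s, coeff i (s * f r) = coeff i s * r
  coeff_zero_mul : ∀ s, coeff 0 (τ * s) = 0
  coeff_succ_mul : ∀ i s, i + 1 < n → coeff (i + 1) (τ * s) = coeff i s
  coeff_one : ∀ i, i < n → coeff i 1 = if i = 0 then 1 else 0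

namespace TruncData

variable {R S : Type u} [Ring R] [Ring S] {f : R →+* S} {τ : S} {n : ℕ}

/-- Truncated polynomial data on the opposite rings. -/
def op (D : TruncData f τ n) : TruncData f.op (MulOpposite.op τ) n where
  coeff i := AddMonoidHom.mulOp (D.coeff i)
  central s := MulOpposite.unop_injective (by simp [D.central])
  pow_eq_zero := by rw [← MulOpposite.op_pow, D.pow_eq_zero, MulOpposite.op_zero]
  sum_coeff s := MulOpposite.unop_injective <| by
    rw [Finset.unop_sum]
    conv_rhs => rw [← D.sum_coeff s.unop]
    refine Finset.sum_congr rfl fun i _ => ?_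
    have : Commute τ (f (D.coeff i s.unop)) := D.central _
    simpa using (this.pow_left i).eq
  coeff_mul i r s := MulOpposite.unop_injective (by simp [D.coeff_mul_right])
  coeff_mul_right i r s := MulOpposite.unop_injective (by simp [D.coeff_mul])
  coeff_zero_mul s := MulOpposite.unop_injective (by simp [← D.central, D.coeff_zero_mul])
  coeff_succ_mul i s h := MulOpposite.unop_injective (by
    simp [← D.central, D.coeff_succ_mul _ _ h])
  coeff_one i h := MulOpposite.unop_injective (by
    rcases i with _ | i <;> simp [D.coeff_one _ h])

variable (D : TruncData f τ n)
include D

theorem coeff_pow_mul (k i : ℕ) (s : S) (h : k + i < n) :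
    D.coeff (k + i) (τ ^ k * s) = D.coeff i s := by
  induction k generalizing i with
  | zero => simp
  | succ k ih =>
    rw [pow_succ', mul_assoc, show k + 1 + i = k + i + 1 by omega,
      D.coeff_succ_mul _ _ (by omega), ih i (by omega)]

theorem coeff_pow (i j : ℕ) (hi : i < n) : D.coeff i (τ ^ j) = if i = j then 1 else 0 := by
  induction j generalizing i with
  | zero => simpa using D.coeff_one i hi
  | succ j ih =>
    rw [pow_succ']
    cases i with
    | zero => simp [D.coeff_zero_mul]
    | succ i => simp [D.coeff_succ_mul _ _ hi, ih i (by omega)]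

theorem coeff_sum (a : ℕ → R) (i : ℕ) (hi : i < n) :
    D.coeff i (∑ j ∈ Finset.range n, f (a j) * τ ^ j) = a i := by
  simp [D.coeff_mul, D.coeff_pow i _ hi, hi]

theorem coind_exact {X Y Z : Type u} [AddCommGroup X] [Module R X] [AddCommGroup Y] [Module R Y]
    [AddCommGroup Z] [Module R Z] {g : X →ₗ[R] Y} {h : Y →ₗ[R] Z} (hgh : Function.Exact g h) :
    Function.Exact (Coind.map f g) (Coind.map f h) := by
  intro φ
  constructor
  · intro hφ
    have key : ∀ s, ∃ x, g x = φ.1 s := fun s => (hgh _).1 (by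
      rw [← Coind.map_apply, hφ]
      rfl)
    choose y hy using key
    refine ⟨⟨⟨⟨fun s => ∑ i ∈ Finset.range n, D.coeff i s • y (τ ^ i), by simp⟩, fun s t => by
      simp [add_smul, Finset.sum_add_distrib]⟩, fun r s => by
        simp [D.coeff_mul, Finset.smul_sum, mul_smul]⟩, Coind.ext fun s => ?_⟩
    conv_rhs => rw [← D.sum_coeff s]
    simp [Coind.map_apply, hy, ← Coind.map_mul]
  · rintro ⟨ψ, rfl⟩
    refine Coind.ext fun s => ?_
    rw [Coind.map_apply, Coind.map_apply]
    exact (hgh _).2 ⟨_, rfl⟩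

/-- The top coefficient pairing, a linear map `S → Hom_R(S, R)`. -/
def toCoind : S →ₗ[S] Coind f R where
  toFun s := ⟨(D.coeff (n - 1)).comp (AddMonoidHom.mulRight s), fun r x => by
    simp [mul_assoc, D.coeff_mul]⟩
  map_add' s t := Coind.ext fun x => by simp [mul_add]
  map_smul' a s := Coind.ext fun x => by simp [Coind.smul_apply, mul_assoc]

theorem toCoind_apply (s x : S) : (D.toCoind s).1 x = D.coeff (n - 1) (x * s) := rfl

theorem toCoind_apply_pow (s : S) (i : ℕ) (hi : i < n) :
    (D.toCoind s).1 (τ ^ i) = D.coeff (n - 1 - i) s := by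
  rw [toCoind_apply]
  conv_lhs => rw [show n - 1 = i + (n - 1 - i) by omega]
  exact D.coeff_pow_mul _ _ _ (by omega)

theorem toCoind_bijective : Function.Bijective D.toCoind := by
  constructor
  · rw [injective_iff_map_eq_zero]
    intro s hs
    rw [← D.sum_coeff s]
    refine Finset.sum_eq_zero fun i hi => ?_
    have hi := Finset.mem_range.1 hi
    have h := D.toCoind_apply_pow s (n - 1 - i) (by omega)
    rw [show n - 1 - (n - 1 - i) = i by omega, hs] at h
    rw [← h]
    simp
  · intro φ
    refine ⟨∑ j ∈ Finset.range n, f (φ.1 (τ ^ (n - 1 - j))) * τ ^ j, Coind.ext fun s => ?_⟩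
    rw [← D.sum_coeff s, map_sum (Subtype.val _), map_sum φ.1]
    refine Finset.sum_congr rfl fun i hi => ?_
    have hi := Finset.mem_range.1 hi
    rw [Coind.map_mul, Coind.map_mul, D.toCoind_apply_pow _ i hi,
      D.coeff_sum (fun j => φ.1 (τ ^ (n - 1 - j))) _ (by omega),
      show n - 1 - (n - 1 - i) = i by omega]

theorem injDimLE_up {m : ℕ} (h : injDimLE R R m) : injDimLE S S m := by
  refine injDimLE.of_linearEquiv (LinearEquiv.ofBijective D.toCoind D.toCoind_bijective) ?_
  obtain ⟨I, _, _, d, aug, hI, haug, h0, hd, hm⟩ := h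
  refine ⟨fun j => Coind f (I j), fun j => inferInstance, fun j => inferInstance,
    fun j => Coind.map f (d j), Coind.map f aug, fun j => Coind.injective f (hI j),
    Coind.map_injective haug, D.coind_exact h0, fun j => D.coind_exact (hd j), fun j hj => ?_⟩
  have := hm j hj
  exact ⟨fun φ ψ => Coind.ext fun s => Subsingleton.elim _ _⟩

/-- The left ideal of `S` of elements with all coefficients in a given left ideal of `R`. -/
def extIdeal (I : Ideal R) : Ideal S where
  carrier := {s | ∀ i, i < n → D.coeff i s ∈ I}
  zero_mem' i _ := by simp
  add_mem' {s t} hs ht i hi := by simpa using I.add_mem (hs i hi) (ht i hi)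
  smul_mem' a s hs := by
    have hτ : ∀ s, (∀ i, i < n → D.coeff i s ∈ I) → ∀ i, i < n → D.coeff i (τ * s) ∈ I := by
      rintro s hs (_ | i) hi
      · simp [D.coeff_zero_mul]
      · rw [D.coeff_succ_mul _ _ hi]
        exact hs i (by omega)
    have hpow : ∀ k : ℕ, ∀ i, i < n → D.coeff i (τ ^ k * s) ∈ I := by
      intro k
      induction k with
      | zero => simpa using hs
      | succ k ih =>
        rw [pow_succ', mul_assoc]
        exact hτ _ ih
    intro i hi
    rw [smul_eq_mul, ← D.sum_coeff a, Finset.sum_mul, map_sum]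
    refine I.sum_mem fun k _ => ?_
    rw [mul_assoc, D.coeff_mul]
    exact I.mul_mem_left _ (hpow k i hi)

theorem smul_eq_of_generators {A B : Type u} [AddCommGroup A] [Module S A] [AddCommGroup B]
    [Module S B] (g : A →+ B) (hf : ∀ r a, g (f r • a) = f r • g a)
    (hτ : ∀ a, g (τ • a) = τ • g a) (s : S) (a : A) : g (s • a) = s • g a := by
  have hpow : ∀ k : ℕ, g (τ ^ k • a) = τ ^ k • g a := by
    intro k
    induction k with
    | zero => simp
    | succ k ih => rw [pow_succ', mul_smul, hτ, ih, mul_smul]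
  rw [← D.sum_coeff s]
  simp [Finset.sum_smul, mul_smul, hf, hpow]

theorem injective_restrict (hn : 0 < n) {M : Type u} [AddCommGroup M] [Module S M]
    (hM : Module.Injective S M) : @Module.Injective R _ M _ (Module.compHom M f) := by
  let := Module.compHom M f
  refine Module.Baer.injective fun I g => ?_
  have hg : ∀ (r : R) (x : I), g (r • x) = f r • g x := g.map_smul
  let G : D.extIdeal I →+ M :=
    { toFun := fun s => ∑ i : Fin n, τ ^ (i : ℕ) • g ⟨D.coeff i s, s.2 i i.2⟩
      map_zero' := by
        refine Finset.sum_eq_zero fun i _ => ?_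
        rw [show (⟨D.coeff i (0 : D.extIdeal I), (0 : D.extIdeal I).2 i i.2⟩ : I) = 0 from
          Subtype.ext (by simp)]
        simp
      map_add' := fun s t => by
        rw [← Finset.sum_add_distrib]
        refine Finset.sum_congr rfl fun i _ => ?_
        rw [← smul_add, ← g.map_add]
        congr 2
        exact Subtype.ext (by simp) }
  have hGf : ∀ r s, G (f r • s) = f r • G s := by
    intro r s
    change ∑ i : Fin n, _ = f r • ∑ i : Fin n, _
    rw [Finset.smul_sum]
    refine Finset.sum_congr rfl fun i _ => ?_
    have hcomm : Commute τ (f r) := D.central _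
    rw [← mul_smul, ← (hcomm.pow_left i).eq, mul_smul, ← hg]
    congr 2
    exact Subtype.ext (by simp [D.coeff_mul])
  have hGτ : ∀ s, G (τ • s) = τ • G s := by
    intro s
    obtain ⟨k, rfl⟩ : ∃ k, n = k + 1 := ⟨n - 1, by omega⟩
    have hlast : τ * τ ^ (Fin.last k : ℕ) = 0 := by
      rw [Fin.val_last, ← pow_succ', D.pow_eq_zero]
    change ∑ i : Fin (k + 1), _ = τ • ∑ i : Fin (k + 1), _
    rw [Fin.sum_univ_succ, Fin.sum_univ_castSucc, smul_add, ← mul_smul, hlast, zero_smul, add_zero, Finset.smul_sum]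
    rw [show g ⟨D.coeff ((0 : Fin (k + 1)) : ℕ) ((τ • s : D.extIdeal I) : S), _⟩ = 0 from ?_]
    · rw [smul_zero, zero_add]
      refine Finset.sum_congr rfl fun i _ => ?_
      rw [← mul_smul, ← pow_succ']
      congr 2
      exact Subtype.ext (by simpa using D.coeff_succ_mul i s (by omega))
    · rw [← g.map_zero]
      congr 1
      exact Subtype.ext (by simpa using D.coeff_zero_mul s)
  let G' : D.extIdeal I →ₗ[S] M :=
    { toFun := G, map_add' := G.map_add, map_smul' := D.smul_eq_of_generators G hGf hGτ }
  obtain ⟨h, hh⟩ := hM.out (D.extIdeal I).subtype Subtype.val_injective G'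
  have hcoeff : ∀ x i, i < n → D.coeff i (f x) = if i = 0 then x else 0 := by
    intro x i hi
    rw [← mul_one (f x), D.coeff_mul, D.coeff_one i hi]
    simp
  refine ⟨
    { toFun := fun r => h (f r)
      map_add' := fun a b => by simp
      map_smul' := fun a b => by
        change h (f (a * b)) = f a • h (f b)
        rw [map_mul, ← smul_eq_mul, h.map_smul] }, fun x hx => ?_⟩
  have hmem : f x ∈ D.extIdeal I := by
    intro i hi
    rw [hcoeff x i hi]
    split_ifs
    · exact hx
    · exact I.zero_mem
  refine (hh ⟨f x, hmem⟩).trans ?_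
  change ∑ i : Fin n, _ = _
  rw [Finset.sum_eq_single ⟨0, hn⟩]
  · rw [pow_zero, one_smul]
    congr 1
    exact Subtype.ext (by simp [hcoeff x 0 hn])
  · intro i _ hi
    have hi0 : (i : ℕ) ≠ 0 := fun h => hi (Fin.ext h)
    rw [show (⟨D.coeff i (f x), hmem i i.2⟩ : I) = 0 from
      Subtype.ext (by simp [hcoeff x i i.2, hi0])]
    simp
  · simp

theorem injDimLE_down (hn : 0 < n) {m : ℕ} (h : injDimLE S S m) : injDimLE R R m := by
  let := Module.compHom S f
  have hS : injDimLE R S m := by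
    obtain ⟨I, _, _, d, aug, hI, haug, h0, hd, hm⟩ := h
    refine ⟨I, inferInstance, fun j => Module.compHom (I j) f, fun j =>
      letI := Module.compHom (I j) f
      letI := Module.compHom (I (j + 1)) f
      { toFun := d j, map_add' := (d j).map_add, map_smul' := fun r => (d j).map_smul (f r) },
      letI := Module.compHom (I 0) f
      { toFun := aug, map_add' := aug.map_add, map_smul' := fun r => aug.map_smul (f r) },
      fun j => D.injective_restrict hn (hI j), haug, h0, hd, hm⟩
  refine injDimLE.of_retract
    { toFun := f, map_add' := f.map_add, map_smul' := fun r x => f.map_mul r x }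
    { toFun := D.coeff 0, map_add' := (D.coeff 0).map_add, map_smul' := D.coeff_mul 0 }
    (fun x => ?_) hS
  change D.coeff 0 (f x) = x
  rw [← mul_one (f x), D.coeff_mul, D.coeff_one 0 hn]
  simp

theorem exists_injDimLE_iff (hn : 0 < n) :
    (∃ m, injDimLE R R m) ↔ ∃ m, injDimLE S S m :=
  ⟨fun ⟨m, h⟩ => ⟨m, D.injDimLE_up h⟩, fun ⟨m, h⟩ => ⟨m, D.injDimLE_down hn h⟩⟩

end TruncData

section TruncPoly

theorem coeff_eq_zero_of_mem_span {p : R[X]} (hp : p ∈ Ideal.span {(X : R[X]) ^ n}) {i : ℕ}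
    (hi : i < n) : p.coeff i = 0 := by
  obtain ⟨q, rfl⟩ := Ideal.mem_span_singleton'.1 hp
  rw [coeff_mul_X_pow', if_neg (by omega)]

instance isTwoSided_span_X_pow : (Ideal.span {(X : R[X]) ^ n}).IsTwoSided where
  mul_mem_of_left {a} b ha := by
    obtain ⟨q, rfl⟩ := Ideal.mem_span_singleton'.1 ha
    exact Ideal.mem_span_singleton'.2 ⟨q * b, by rw [mul_assoc, mul_assoc, X_pow_mul]⟩

theorem truncMk_surjective : Function.Surjective (truncMk R n) := RingQuot.mkRingHom_surjective _

theorem truncMk_X_pow : truncMk R n (X ^ n) = 0 := by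
  rw [← map_zero (truncMk R n)]
  exact RingQuot.mkRingHom_rel ⟨rfl, rfl⟩

/-- Comparison of `R[t]/(t^n)` with the quotient by the left ideal generated by `t^n`. -/
def truncToQuotient : TruncPoly R n →+* R[X] ⧸ Ideal.span {(X : R[X]) ^ n} :=
  RingQuot.lift ⟨Ideal.Quotient.mk _, by
    rintro _ _ ⟨rfl, rfl⟩
    rw [map_zero, Ideal.Quotient.eq_zero_iff_mem]
    exact Ideal.mem_span_singleton_self _⟩

theorem coeff_eq_of_truncMk_eq {p q : R[X]} (h : truncMk R n p = truncMk R n q) {i : ℕ}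
    (hi : i < n) : p.coeff i = q.coeff i := by
  have h' := congrArg (truncToQuotient R n) h
  simp only [truncToQuotient, truncMk, RingQuot.lift_mkRingHom_apply] at h'
  rw [Ideal.Quotient.eq] at h'
  rw [← sub_eq_zero, ← coeff_sub]
  exact coeff_eq_zero_of_mem_span R n h' hi

/-- The coefficient functions on `R[t]/(t^n)`, zero in degrees `≥ n`. -/
def truncCoeff (i : ℕ) : TruncPoly R n →+ R where
  toFun s := if i < n then (Function.surjInv (truncMk_surjective R n) s).coeff i else 0
  map_zero' := by
    split_ifs with hi
    · exact (coeff_eq_of_truncMk_eq R n (q := 0)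
        (by rw [Function.surjInv_eq (truncMk_surjective R n), map_zero]) hi).trans (coeff_zero i)
    · rfl
  map_add' s t := by
    split_ifs with hi
    · rw [← coeff_add]
      exact coeff_eq_of_truncMk_eq R n
        (by simp [Function.surjInv_eq (truncMk_surjective R n)]) hi
    · simp

theorem truncCoeff_truncMk (i : ℕ) (p : R[X]) :
    truncCoeff R n i (truncMk R n p) = if i < n then p.coeff i else 0 := by
  change (if i < n then _ else _) = _
  split_ifs with hi
  · exact coeff_eq_of_truncMk_eq R n (Function.surjInv_eq (truncMk_surjective R n) _) hi
  · rfl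

theorem truncMk_eq_sum (p : R[X]) :
    ∑ i ∈ Finset.range n, truncC R n (p.coeff i) * tgen R n ^ i = truncMk R n p := by
  induction p using Polynomial.induction_on' with
  | add p q hp hq => simp [add_mul, Finset.sum_add_distrib, hp, hq]
  | monomial k a =>
    have hk : truncMk R n (monomial k a) = truncC R n a * tgen R n ^ k := by
      rw [← C_mul_X_pow_eq_monomial, map_mul, map_pow]
      rfl
    rw [hk]
    by_cases h : k < n
    · rw [Finset.sum_eq_single_of_mem k (Finset.mem_range.2 h)]
      · simp
      · intro i _ hi
        simp [coeff_monomial, hi.symm]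
    · have h0 : tgen R n ^ k = 0 := by
        have : tgen R n ^ n = 0 := by
          rw [tgen, ← map_pow, truncMk_X_pow]
        exact pow_eq_zero_of_le (not_lt.1 h) this
      rw [h0, mul_zero]
      refine Finset.sum_eq_zero fun i hi => ?_
      have : k ≠ i := by
        have := Finset.mem_range.1 hi
        omega
      simp [coeff_monomial, this]

/-- The coefficient functions of `R[t]/(t^n)` form truncated polynomial data. -/
def truncPolyData : TruncData (truncC R n) (tgen R n) n where
  coeff := truncCoeff R n
  central s := by
    obtain ⟨p, rfl⟩ := truncMk_surjective R n s
    rw [tgen, ← map_mul, ← map_mul, X_mul]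
  pow_eq_zero := by rw [tgen, ← map_pow, truncMk_X_pow]
  sum_coeff s := by
    obtain ⟨p, rfl⟩ := truncMk_surjective R n s
    conv_rhs => rw [← truncMk_eq_sum]
    refine Finset.sum_congr rfl fun i hi => ?_
    rw [truncCoeff_truncMk, if_pos (Finset.mem_range.1 hi)]
  coeff_mul i r s := by
    obtain ⟨p, rfl⟩ := truncMk_surjective R n s
    rw [truncC, RingHom.comp_apply, ← map_mul, truncCoeff_truncMk, truncCoeff_truncMk]
    split_ifs <;> simp
  coeff_mul_right i r s := by
    obtain ⟨p, rfl⟩ := truncMk_surjective R n s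
    rw [truncC, RingHom.comp_apply, ← map_mul, truncCoeff_truncMk, truncCoeff_truncMk]
    split_ifs <;> simp
  coeff_zero_mul s := by
    obtain ⟨p, rfl⟩ := truncMk_surjective R n s
    rw [tgen, ← map_mul, truncCoeff_truncMk]
    simp
  coeff_succ_mul i s hi := by
    obtain ⟨p, rfl⟩ := truncMk_surjective R n s
    rw [tgen, ← map_mul, truncCoeff_truncMk, truncCoeff_truncMk, if_pos hi, if_pos (by omega),
      coeff_X_mul]
  coeff_one i hi := by
    rw [← map_one (truncMk R n), truncCoeff_truncMk, if_pos hi, coeff_one]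

end TruncPoly

/-- **Statement 15.** Let `R` be an Artin algebra and `n ≥ 2`. Then `R` satisfies the
Gorenstein Symmetry Conjecture (the self-injective dimension of `R` as a left module over
itself is finite exactly when its self-injective dimension as a right module over itself is
finite) iff `R[t]/(t^n)` does. -/
theorem statement15 (R : Type u) [Ring R] (C : Type u) [CommRing C] [IsArtinianRing C]
    [Algebra C R] (hfg : Module.Finite C R) (n : ℕ) (hn : 2 ≤ n) :
    ((∃ m, injDimLE R R m) ↔ (∃ m, injDimLE Rᵐᵒᵖ Rᵐᵒᵖ m)) ↔
      ((∃ m, injDimLE (TruncPoly R n) (TruncPoly R n) m) ↔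
        (∃ m, injDimLE (TruncPoly R n)ᵐᵒᵖ (TruncPoly R n)ᵐᵒᵖ m)) := by
  have hn0 : 0 < n := by omega
  rw [(truncPolyData R n).exists_injDimLE_iff hn0, (truncPolyData R n).op.exists_injDimLE_iff hn0]

end Paper
end
end
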